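/- arXiv:1902.06186 — 15 statements merged into one kernel-verified Lean document; each statement's English description precedes it below -/
import Mathlib

section
/- Let X be a metric space, f : X → ℝ ∪ {+∞}, φ : ℝ → ℝ ∪ {+∞}, and let x ∈ X satisfy f(x) < +∞ and φ(f(x)) < +∞. Suppose φ is nondecreasing on ℝ and is differentiable at f(x) with φ'(f(x)) > 0. Then |∇(φ∘f)|(x) = φ'(f(x)) · |∇f|(x), where the composition uses the convention φ(+∞) = +∞ and the product is taken in [0,+∞] (so that φ'(f(x))·(+∞) = +∞). -/
open Filter
open scoped ENNReal

/-- The positive part of an extended real number, as an element of `[0,∞]`. -/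
noncomputable def EReal.posPart (a : EReal) : ℝ≥0∞ :=
  if a = ⊤ then ⊤ else ENNReal.ofReal a.toReal

/-- The (strong) slope `|∇f|(x)` of an extended-real-valued function `f` at `x`:
`limsup_{u → x, u ≠ x} [f(x) − f(u)]₊ / d(x,u)`, with the convention that it equals `+∞`
when `f x = +∞`. -/
noncomputable def eslope {X : Type*} [PseudoMetricSpace X] (f : X → EReal) (x : X) : ℝ≥0∞ :=
  if f x = ⊤ then ⊤
  else Filter.limsup (fun u => (f x - f u).posPart / edist x u) (nhdsWithin x {x}ᶜ)

theorem EReal.posPart_coe (r : ℝ) : EReal.posPart (r : EReal) = ENNReal.ofReal r := by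
  simp [EReal.posPart]

theorem EReal.posPart_of_nonpos {a : EReal} (ha : a ≤ 0) : EReal.posPart a = 0 := by
  have h : a ≠ ⊤ := fun h => by simp [h] at ha
  rw [EReal.posPart, if_neg h, ENNReal.ofReal_eq_zero]
  exact EReal.toReal_nonpos ha

/-- If the numerator frequently stays above a positive constant, the difference quotients
are unbounded near the point. -/
theorem limsup_div_edist_eq_top {X : Type*} [PseudoMetricSpace X] {g : X → ℝ≥0∞} {x : X} {r : ℝ}
    (hr : 0 < r) (hg : ∃ᶠ u in nhdsWithin x {x}ᶜ, ENNReal.ofReal r ≤ g u) :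
    limsup (fun u => g u / edist x u) (nhdsWithin x {x}ᶜ) = ⊤ := by
  refine ENNReal.eq_top_of_forall_nnreal_le fun M => ?_
  refine le_limsup_of_frequently_le ?_
  have hpos : 0 < r / (M + 1) := by positivity
  have hball : ∀ᶠ u in nhdsWithin x {x}ᶜ, dist u x < r / (M + 1) :=
    nhdsWithin_le_nhds (Metric.ball_mem_nhds x hpos)
  refine (hg.and_eventually hball).mono ?_
  rintro u ⟨hu, hd⟩
  have hmul : (M : ℝ≥0∞) * edist x u ≤ g u := by
    refine le_trans ?_ hu
    rw [edist_dist, ← ENNReal.ofReal_coe_nnreal, ← ENNReal.ofReal_mul M.coe_nonneg]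
    apply ENNReal.ofReal_le_ofReal
    rw [lt_div_iff₀ (by positivity), dist_comm] at hd
    nlinarith [dist_nonneg (x := x) (y := u)]
  refine ENNReal.le_div_iff_mul_le (Or.inr ?_) (Or.inl (edist_ne_top x u)) |>.2 hmul
  exact (lt_of_lt_of_le (ENNReal.ofReal_pos.2 hr) hu).ne'

/-- Two-sided comparison of the increments of a nondecreasing function with those of the
identity, close to a point of differentiability. -/
theorem exists_posPart_sub_bounds {φ : ℝ → EReal} (hφbot : ∀ t, φ t ≠ ⊥) (hφmono : Monotone φ)
    {a c δ : ℝ} (hφa : φ a ≠ ⊤) (hderiv : HasDerivAt (fun t => (φ t).toReal) c a) (hδ : 0 < δ)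
    (hδc : δ < c) :
    ∃ η > 0, ∀ y : EReal, y ≠ ⊥ → ((a - η : ℝ) : EReal) < y →
      ENNReal.ofReal (c - δ) * ((a : EReal) - y).posPart
          ≤ (φ a - if y = ⊤ then (⊤ : EReal) else φ y.toReal).posPart ∧
        (φ a - if y = ⊤ then (⊤ : EReal) else φ y.toReal).posPart
          ≤ ENNReal.ofReal (c + δ) * ((a : EReal) - y).posPart := by
  obtain ⟨η, hη, hb⟩ := Metric.eventually_nhds_iff.1 (hderiv.isLittleO.def hδ)
  refine ⟨η, hη, fun y hybot hy => ?_⟩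
  induction y with
  | bot => exact absurd rfl hybot
  | top => simp [EReal.posPart_of_nonpos]
  | coe t =>
    simp only [EReal.coe_ne_top, if_false, EReal.toReal_coe]
    rcases le_or_gt a t with hat | hta
    · rw [EReal.posPart_of_nonpos (a := (a : EReal) - t), EReal.posPart_of_nonpos]
      · simp
      · exact EReal.sub_nonpos.2 (hφmono hat)
      · exact EReal.sub_nonpos.2 (by exact_mod_cast hat)
    · have hφt : φ t ≠ ⊤ := ne_top_of_le_ne_top hφa (hφmono hta.le)
      have hη' : a - η < t := by exact_mod_cast hy
      have key := hb (y := t) (by rw [Real.dist_eq, abs_lt]; constructor <;> linarith)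
      rw [← EReal.coe_toReal hφa (hφbot a), ← EReal.coe_toReal hφt (hφbot t), ← EReal.coe_sub,
        ← EReal.coe_sub, EReal.posPart_coe, EReal.posPart_coe,
        ← ENNReal.ofReal_mul (by linarith), ← ENNReal.ofReal_mul (by linarith)]
      simp only [smul_eq_mul, Real.norm_eq_abs] at key
      rw [abs_of_neg (sub_neg.2 hta), abs_le] at key
      constructor <;> apply ENNReal.ofReal_le_ofReal <;> nlinarith [key.1, key.2]

/-- Slope chain rule: if `f : X → ℝ ∪ {+∞}`, `φ : ℝ → ℝ ∪ {+∞}` is nondecreasing and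
differentiable at `f x` (so, in particular, finite near `f x`) with `φ'(f x) = c > 0`,
and `f x`, `φ (f x)` are finite, then `|∇(φ∘f)|(x) = φ'(f x) · |∇f|(x)`, where the
composition uses the convention `φ(+∞) = +∞` and the product is taken in `[0,+∞]`. -/
theorem slope_chain_rule {X : Type*} [MetricSpace X] (f : X → EReal) (φ : ℝ → EReal)
    (hfbot : ∀ u, f u ≠ ⊥) (hφbot : ∀ t, φ t ≠ ⊥)
    (x : X) (hfx : f x ≠ ⊤) (hφfx : φ ((f x).toReal) ≠ ⊤)
    (hφmono : Monotone φ)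
    (hφfin : ∀ᶠ t in nhds ((f x).toReal), φ t ≠ ⊤)
    (c : ℝ) (hc : 0 < c)
    (hderiv : HasDerivAt (fun t => (φ t).toReal) c ((f x).toReal)) :
    eslope (fun u => if f u = ⊤ then (⊤ : EReal) else φ ((f u).toReal)) x
      = ENNReal.ofReal c * eslope f x := by
  generalize hg : (fun u => if f u = ⊤ then (⊤ : EReal) else φ ((f u).toReal)) = g
  have hgu (u : X) : g u = if f u = ⊤ then (⊤ : EReal) else φ ((f u).toReal) := by rw [← hg]
  have hgx : g x = φ ((f x).toReal) := by rw [hgu, if_neg hfx]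
  have hfxa : f x = ((f x).toReal : EReal) := (EReal.coe_toReal hfx (hfbot x)).symm
  generalize (f x).toReal = a at *
  have hc0 : ENNReal.ofReal c ≠ 0 := (ENNReal.ofReal_pos.2 hc).ne'
  rw [eslope, eslope, if_neg hfx, if_neg (hgx ▸ hφfx), hgx, hfxa]
  by_cases hlsc : ∀ η > 0, ∀ᶠ u in nhdsWithin x {x}ᶜ, ((a - η : ℝ) : EReal) < f u
  · have hlim {s : ℝ → ℝ} (hs : Continuous s) (hs0 : s 0 = c) (L : ℝ≥0∞) :
        Tendsto (fun δ => ENNReal.ofReal (s δ) * L) (nhdsWithin 0 (Set.Ioi 0))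
          (nhds (ENNReal.ofReal c * L)) := by
      refine ENNReal.Tendsto.mul_const ?_ (Or.inl hc0)
      rw [← hs0]
      exact ((ENNReal.continuous_ofReal.comp hs).tendsto 0).mono_left nhdsWithin_le_nhds
    have hsmall : ∀ᶠ δ : ℝ in nhdsWithin 0 (Set.Ioi 0), 0 < δ ∧ δ < c := Ioo_mem_nhdsGT hc
    apply le_antisymm
    · refine ge_of_tendsto (hlim (s := fun δ => c + δ) (by fun_prop) (by simp) _) ?_
      filter_upwards [hsmall] with δ hδ
      obtain ⟨η, hη, hb⟩ := exists_posPart_sub_bounds hφbot hφmono hφfx hderiv hδ.1 hδ.2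
      rw [← ENNReal.limsup_const_mul_of_ne_top ENNReal.ofReal_ne_top]
      refine limsup_le_limsup ?_
      filter_upwards [hlsc η hη] with u hu
      rw [← mul_div_assoc, hgu]
      exact ENNReal.div_le_div_right (hb _ (hfbot u) hu).2 _
    · refine le_of_tendsto (hlim (s := fun δ => c - δ) (by fun_prop) (by simp) _) ?_
      filter_upwards [hsmall] with δ hδ
      obtain ⟨η, hη, hb⟩ := exists_posPart_sub_bounds hφbot hφmono hφfx hderiv hδ.1 hδ.2
      rw [← ENNReal.limsup_const_mul_of_ne_top ENNReal.ofReal_ne_top]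
      refine limsup_le_limsup ?_
      filter_upwards [hlsc η hη] with u hu
      rw [← mul_div_assoc, hgu]
      exact ENNReal.div_le_div_right (hb _ (hfbot u) hu).1 _
  · push Not at hlsc
    obtain ⟨ε, hε, hfreq⟩ := hlsc
    obtain ⟨η, hη, hb⟩ :=
      exists_posPart_sub_bounds hφbot hφmono hφfx hderiv (half_pos hc) (half_lt_self hc)
    obtain ⟨ρ, hρ, hρε, hρη⟩ : ∃ ρ : ℝ, 0 < ρ ∧ ρ ≤ ε ∧ ρ < η :=
      ⟨min ε (η / 2), by positivity, min_le_left _ _, (min_le_right _ _).trans_lt (by linarith)⟩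
    have hreal {u : X} (hu : f u ≤ ((a - ε : ℝ) : EReal)) :
        ∃ t : ℝ, f u = t ∧ t ≤ a - ε := by
      have h := EReal.coe_toReal (ne_top_of_le_ne_top (EReal.coe_ne_top _) hu) (hfbot u)
      refine ⟨(f u).toReal, h.symm, ?_⟩
      rw [← h] at hu
      exact_mod_cast hu
    have hρb := (hb ((a - ρ : ℝ) : EReal) (EReal.coe_ne_bot _)
      (by exact_mod_cast sub_lt_sub_left hρη a)).1
    have hφρ : φ (a - ρ) ≠ ⊤ := ne_top_of_le_ne_top hφfx (hφmono (by linarith))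
    simp only [EReal.coe_ne_top, if_false, EReal.toReal_coe] at hρb
    rw [← EReal.coe_sub, EReal.posPart_coe, ← EReal.coe_toReal hφfx (hφbot a),
      ← EReal.coe_toReal hφρ (hφbot _), ← EReal.coe_sub, EReal.posPart_coe,
      ← ENNReal.ofReal_mul (by linarith)] at hρb
    rw [limsup_div_edist_eq_top (r := (c - c / 2) * (a - (a - ρ))), limsup_div_edist_eq_top hε,
      ENNReal.mul_top hc0]
    · refine hfreq.mono fun u hu => ?_
      obtain ⟨t, ht, hta⟩ := hreal hu
      rw [ht, ← EReal.coe_sub, EReal.posPart_coe]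
      exact ENNReal.ofReal_le_ofReal (by linarith)
    · have h1 : 0 < c - c / 2 := by linarith
      have h2 : 0 < a - (a - ρ) := by linarith
      positivity
    · refine hfreq.mono fun u hu => ?_
      obtain ⟨t, ht, hta⟩ := hreal hu
      have hle : φ t ≤ φ (a - ρ) := hφmono (by linarith)
      have hφt : φ t ≠ ⊤ := ne_top_of_le_ne_top hφρ hle
      rw [hgu, ht, if_neg (EReal.coe_ne_top t), EReal.toReal_coe,
        ← EReal.coe_toReal hφfx (hφbot a), ← EReal.coe_toReal hφt (hφbot t), ← EReal.coe_sub,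
        EReal.posPart_coe]
      refine hρb.trans (ENNReal.ofReal_le_ofReal ?_)
      exact sub_le_sub_left (EReal.toReal_le_toReal hle (hφbot t) hφρ) _
end

section
/- Let X be a normed vector space, Ω₁,…,Ωₙ ⊆ X, x̄ ∈ ⋂ᵢ₌₁ⁿ Ωᵢ, and let φ(t) := α⁻¹(t^q + βt) for all t ≥ 0, with some α > 0, β > 0 and q > 0. If the collection {Ω₁,…,Ωₙ} is φ-semitransversal (respectively, φ-subtransversal, φ-transversal) at x̄, then it is α'-semitransversal (respectively, α'-subtransversal, α'-transversal) of order q' at x̄, where: (i) if q < 1, then q' = q and α' is any number in (0,α); (ii) if q = 1, then q' = 1 and α' := α(1+β)⁻¹; (iii) if q > 1, then q' = 1 and α' is any number in (0, αβ⁻¹). -/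
open Set Filter
open scoped ENNReal

variable {X : Type*} [NormedAddCommGroup X] [NormedSpace ℝ X]

/-- The collection `{Ω i}` is `φ`-semitransversal at `x₀` with `δ > 0`:
`⋂ᵢ (Ωᵢ − xᵢ) ∩ B_ρ(x₀) ≠ ∅` for all `ρ ∈ (0,δ)` and all `xᵢ` with `φ(maxᵢ ‖xᵢ‖) < ρ`. -/
def SemitransversalWith {n : ℕ} (Ω : Fin n → Set X) (x₀ : X) (φ : ℝ → ℝ) (δ : ℝ) : Prop :=
  ∀ ρ : ℝ, 0 < ρ → ρ < δ → ∀ x : Fin n → X, φ (⨆ i, ‖x i‖) < ρ →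
    ((⋂ i, (fun u => u - x i) '' Ω i) ∩ Metric.ball x₀ ρ).Nonempty

/-- The collection `{Ω i}` is `φ`-subtransversal at `x₀` with `δ₁, δ₂ > 0`:
`⋂ᵢ Ωᵢ ∩ B_ρ(x) ≠ ∅` for all `ρ ∈ (0,δ₁)` and all `x ∈ B_{δ₂}(x₀)` with
`φ(maxᵢ d(x,Ωᵢ)) < ρ`. -/
def SubtransversalWith {n : ℕ} (Ω : Fin n → Set X) (x₀ : X) (φ : ℝ → ℝ) (δ₁ δ₂ : ℝ) : Prop :=
  ∀ ρ : ℝ, 0 < ρ → ρ < δ₁ → ∀ x : X, x ∈ Metric.ball x₀ δ₂ →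
    φ (⨆ i, Metric.infDist x (Ω i)) < ρ → ((⋂ i, Ω i) ∩ Metric.ball x ρ).Nonempty

/-- The collection `{Ω i}` is `φ`-transversal at `x₀` with `δ₁, δ₂ > 0`:
`⋂ᵢ (Ωᵢ − ωᵢ − xᵢ) ∩ ρ𝔹 ≠ ∅` for all `ρ ∈ (0,δ₁)`, `ωᵢ ∈ Ωᵢ ∩ B_{δ₂}(x₀)` and `xᵢ`
with `φ(maxᵢ ‖xᵢ‖) < ρ`. -/
def TransversalWith {n : ℕ} (Ω : Fin n → Set X) (x₀ : X) (φ : ℝ → ℝ) (δ₁ δ₂ : ℝ) : Prop :=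
  ∀ ρ : ℝ, 0 < ρ → ρ < δ₁ → ∀ ω x : Fin n → X,
    (∀ i, ω i ∈ Ω i ∩ Metric.ball x₀ δ₂) → φ (⨆ i, ‖x i‖) < ρ →
    ((⋂ i, (fun u => u - ω i - x i) '' Ω i) ∩ Metric.ball (0 : X) ρ).Nonempty

/-- `{Ω i}` is `φ`-semitransversal at `x₀` (with some `δ > 0`). -/
def SemitransversalAt {n : ℕ} (Ω : Fin n → Set X) (x₀ : X) (φ : ℝ → ℝ) : Prop :=
  ∃ δ > (0 : ℝ), SemitransversalWith Ω x₀ φ δ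

/-- `{Ω i}` is `φ`-subtransversal at `x₀` (with some `δ₁, δ₂ > 0`). -/
def SubtransversalAt {n : ℕ} (Ω : Fin n → Set X) (x₀ : X) (φ : ℝ → ℝ) : Prop :=
  ∃ δ₁ > (0 : ℝ), ∃ δ₂ > (0 : ℝ), SubtransversalWith Ω x₀ φ δ₁ δ₂

/-- `{Ω i}` is `φ`-transversal at `x₀` (with some `δ₁, δ₂ > 0`). -/
def TransversalAt {n : ℕ} (Ω : Fin n → Set X) (x₀ : X) (φ : ℝ → ℝ) : Prop :=
  ∃ δ₁ > (0 : ℝ), ∃ δ₂ > (0 : ℝ), TransversalWith Ω x₀ φ δ₁ δ₂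

/-- The Hölder gauge `t ↦ α⁻¹ t^q`; `α`-(semi/sub)transversality of order `q` is
(semi/sub)transversality with respect to this gauge. -/
noncomputable def holderGauge (α q : ℝ) : ℝ → ℝ := fun t => α⁻¹ * t ^ q

lemma SemitransversalAt.of_gauge_le {n : ℕ} {Ω : Fin n → Set X} {x₀ : X} {φ ψ : ℝ → ℝ} {ε : ℝ}
    (hε : 0 < ε) (h : ∀ t, 0 ≤ t → ψ t < ε → φ t ≤ ψ t) :
    SemitransversalAt Ω x₀ φ → SemitransversalAt Ω x₀ ψ := by
  rintro ⟨δ, hδ, H⟩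
  refine ⟨min δ ε, lt_min hδ hε, fun ρ hρ hρδ x hx => ?_⟩
  obtain ⟨hρ₁, hρ₂⟩ := lt_min_iff.1 hρδ
  exact H ρ hρ hρ₁ x
    ((h _ (Real.iSup_nonneg fun i => norm_nonneg _) (hx.trans hρ₂)).trans_lt hx)

lemma SubtransversalAt.of_gauge_le {n : ℕ} {Ω : Fin n → Set X} {x₀ : X} {φ ψ : ℝ → ℝ} {ε : ℝ}
    (hε : 0 < ε) (h : ∀ t, 0 ≤ t → ψ t < ε → φ t ≤ ψ t) :
    SubtransversalAt Ω x₀ φ → SubtransversalAt Ω x₀ ψ := by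
  rintro ⟨δ₁, hδ₁, δ₂, hδ₂, H⟩
  refine ⟨min δ₁ ε, lt_min hδ₁ hε, δ₂, hδ₂, fun ρ hρ hρδ x hxδ hx => ?_⟩
  obtain ⟨hρ₁, hρ₂⟩ := lt_min_iff.1 hρδ
  exact H ρ hρ hρ₁ x hxδ
    ((h _ (Real.iSup_nonneg fun i => Metric.infDist_nonneg) (hx.trans hρ₂)).trans_lt hx)

lemma TransversalAt.of_gauge_le {n : ℕ} {Ω : Fin n → Set X} {x₀ : X} {φ ψ : ℝ → ℝ} {ε : ℝ}
    (hε : 0 < ε) (h : ∀ t, 0 ≤ t → ψ t < ε → φ t ≤ ψ t) :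
    TransversalAt Ω x₀ φ → TransversalAt Ω x₀ ψ := by
  rintro ⟨δ₁, hδ₁, δ₂, hδ₂, H⟩
  refine ⟨min δ₁ ε, lt_min hδ₁ hε, δ₂, hδ₂, fun ρ hρ hρδ ω x hω hx => ?_⟩
  obtain ⟨hρ₁, hρ₂⟩ := lt_min_iff.1 hρδ
  exact H ρ hρ hρ₁ ω x hω
    ((h _ (Real.iSup_nonneg fun i => norm_nonneg _) (hx.trans hρ₂)).trans_lt hx)

/-- The transversality properties with a gauge `φ` that is dominated near `0` by a Hölder gauge
imply the corresponding Hölder properties. -/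
lemma transversality_holderGauge_of_eventually_le {n : ℕ} (Ω : Fin n → Set X) (x₀ : X)
    {φ : ℝ → ℝ} {a p : ℝ} (ha : 0 < a) (hp : 0 < p)
    (h : ∀ᶠ t in nhds (0 : ℝ), 0 ≤ t → φ t ≤ holderGauge a p t) :
    (SemitransversalAt Ω x₀ φ → SemitransversalAt Ω x₀ (holderGauge a p)) ∧
    (SubtransversalAt Ω x₀ φ → SubtransversalAt Ω x₀ (holderGauge a p)) ∧
    (TransversalAt Ω x₀ φ → TransversalAt Ω x₀ (holderGauge a p)) := by
  obtain ⟨η, hη, H⟩ := Metric.eventually_nhds_iff.1 h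
  have hε : 0 < holderGauge a p η := mul_pos (inv_pos.2 ha) (Real.rpow_pos_of_pos hη p)
  have hle : ∀ t, 0 ≤ t → holderGauge a p t < holderGauge a p η → φ t ≤ holderGauge a p t := by
    intro t ht htη
    have hlt : t < η :=
      (Real.rpow_lt_rpow_iff ht hη.le hp).1 (lt_of_mul_lt_mul_left htη (inv_pos.2 ha).le)
    exact H (by rwa [Real.dist_0_eq_abs, abs_of_nonneg ht]) ht
  exact ⟨SemitransversalAt.of_gauge_le hε hle, SubtransversalAt.of_gauge_le hε hle,
    TransversalAt.of_gauge_le hε hle⟩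

lemma eventually_mul_rpow_lt {b c r : ℝ} (hr : 0 < r) (hc : 0 < c) :
    ∀ᶠ t in nhds (0 : ℝ), b * t ^ r < c := by
  have hcont : ContinuousAt (fun t : ℝ => b * t ^ r) 0 :=
    continuousAt_const.mul (Real.continuousAt_rpow_const 0 r (Or.inr hr.le))
  exact hcont.eventually_lt_const (by simpa [Real.zero_rpow hr.ne'] using hc)

/-- For `φ(t) = α⁻¹(t^q + βt)` with `α, β, q > 0`: `φ`-(semi/sub)transversality at `x₀`
implies `α'`-(semi/sub)transversality of order `q'` at `x₀`, where (i) if `q < 1` then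
`q' = q` and `α'` is any number in `(0,α)`; (ii) if `q = 1` then `q' = 1` and
`α' = α(1+β)⁻¹`; (iii) if `q > 1` then `q' = 1` and `α'` is any number in `(0,αβ⁻¹)`. -/
theorem holder_type_approximation {n : ℕ} (Ω : Fin n → Set X) (x₀ : X)
    (hx₀ : x₀ ∈ ⋂ i, Ω i) (α β q : ℝ) (hα : 0 < α) (hβ : 0 < β) (hq : 0 < q)
    (φ : ℝ → ℝ) (hφ : ∀ t : ℝ, 0 ≤ t → φ t = α⁻¹ * (t ^ q + β * t)) :
    (q < 1 → ∀ α' : ℝ, 0 < α' → α' < α →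
      (SemitransversalAt Ω x₀ φ → SemitransversalAt Ω x₀ (holderGauge α' q)) ∧
      (SubtransversalAt Ω x₀ φ → SubtransversalAt Ω x₀ (holderGauge α' q)) ∧
      (TransversalAt Ω x₀ φ → TransversalAt Ω x₀ (holderGauge α' q))) ∧
    (q = 1 →
      (SemitransversalAt Ω x₀ φ →
        SemitransversalAt Ω x₀ (holderGauge (α * (1 + β)⁻¹) 1)) ∧
      (SubtransversalAt Ω x₀ φ →
        SubtransversalAt Ω x₀ (holderGauge (α * (1 + β)⁻¹) 1)) ∧
      (TransversalAt Ω x₀ φ →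
        TransversalAt Ω x₀ (holderGauge (α * (1 + β)⁻¹) 1))) ∧
    (1 < q → ∀ α' : ℝ, 0 < α' → α' < α * β⁻¹ →
      (SemitransversalAt Ω x₀ φ → SemitransversalAt Ω x₀ (holderGauge α' 1)) ∧
      (SubtransversalAt Ω x₀ φ → SubtransversalAt Ω x₀ (holderGauge α' 1)) ∧
      (TransversalAt Ω x₀ φ → TransversalAt Ω x₀ (holderGauge α' 1))) := by
  refine ⟨fun hq1 α' hα' hlt => ?_, fun hq1 => ?_, fun hq1 α' hα' hlt => ?_⟩
  · refine transversality_holderGauge_of_eventually_le Ω x₀ hα' hq ?_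
    have hc : 0 < α / α' - 1 := sub_pos.2 ((one_lt_div hα').2 hlt)
    filter_upwards [eventually_mul_rpow_lt (b := β) (sub_pos.2 hq1) hc] with t ht ht0
    have hsplit : t = t ^ (1 - q) * t ^ q := by
      rw [← Real.rpow_add_of_nonneg ht0 (sub_pos.2 hq1).le hq.le, sub_add_cancel, Real.rpow_one]
    rw [hφ t ht0, holderGauge]
    calc α⁻¹ * (t ^ q + β * t) = α⁻¹ * ((1 + β * t ^ (1 - q)) * t ^ q) := by
          linear_combination α⁻¹ * β * hsplit
      _ ≤ α⁻¹ * (α / α' * t ^ q) := by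
          gcongr
          linarith
      _ = α'⁻¹ * t ^ q := by field_simp
  · subst hq1
    refine transversality_holderGauge_of_eventually_le Ω x₀ (by positivity) one_pos
      (Eventually.of_forall fun t ht => le_of_eq ?_)
    rw [hφ t ht, holderGauge, Real.rpow_one]
    field_simp
  · refine transversality_holderGauge_of_eventually_le Ω x₀ hα' one_pos ?_
    have hc : 0 < α / α' - β := by
      rw [sub_pos, lt_div_iff₀ hα', mul_comm]
      rwa [← div_eq_mul_inv, lt_div_iff₀ hβ] at hlt
    filter_upwards [eventually_mul_rpow_lt (b := 1) (sub_pos.2 hq1) hc] with t ht ht0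
    have hsplit : t ^ q = t ^ (q - 1) * t := by
      conv_rhs => rw [← Real.rpow_one t, ← Real.rpow_mul ht0, one_mul,
        ← Real.rpow_add_of_nonneg ht0 (sub_pos.2 hq1).le zero_le_one, sub_add_cancel]
    rw [hφ t ht0, holderGauge, Real.rpow_one]
    calc α⁻¹ * (t ^ q + β * t) = α⁻¹ * ((t ^ (q - 1) + β) * t) := by
          rw [hsplit]
          ring
      _ ≤ α⁻¹ * (α / α' * t) := by
          gcongr
          linarith
      _ = α'⁻¹ * t := by field_simp
end

section
/- Let X be a normed vector space, Ω₁,…,Ωₙ ⊆ X, x̄ ∈ ⋂ᵢ₌₁ⁿ Ωᵢ, and let φ : [0,∞) → [0,∞) be continuous, strictly increasing, with φ(0) = 0 and φ(t) → ∞ as t → ∞. If {Ω₁,…,Ωₙ} is φ-transversal at x̄ with some δ₁ > 0 and δ₂ > 0, then it is φ-semitransversal at x̄ with δ₁, and it is φ-subtransversal at x̄ with any δ₁' ∈ (0,δ₁) and δ₂' > 0 such that φ⁻¹(δ₁') + δ₂' ≤ δ₂. -/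
open Set Filter
open scoped ENNReal

variable {X : Type*} [NormedAddCommGroup X] [NormedSpace ℝ X]

/-- If `{Ω₁,…,Ωₙ}` is `φ`-transversal at `x₀` with `δ₁` and `δ₂`, then it is
`φ`-semitransversal at `x₀` with `δ₁`, and `φ`-subtransversal at `x₀` with any
`δ₁' ∈ (0,δ₁)` and `δ₂' > 0` such that `φ⁻¹(δ₁') + δ₂' ≤ δ₂`. -/
theorem semitransversal_and_subtransversal_of_transversal {n : ℕ} (Ω : Fin n → Set X)
    (x₀ : X) (hx₀ : x₀ ∈ ⋂ i, Ω i)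
    (φ φinv : ℝ → ℝ) (hmono : StrictMonoOn φ (Set.Ici 0)) (hcont : ContinuousOn φ (Set.Ici 0))
    (hzero : φ 0 = 0) (hlim : Tendsto φ atTop atTop)
    (hinv₁ : ∀ t : ℝ, 0 ≤ t → φinv (φ t) = t) (hinv₂ : ∀ t : ℝ, 0 ≤ t → φ (φinv t) = t)
    (hinvnn : ∀ t : ℝ, 0 ≤ t → 0 ≤ φinv t)
    (δ₁ δ₂ : ℝ) (hδ₁ : 0 < δ₁) (hδ₂ : 0 < δ₂)
    (htr : TransversalWith Ω x₀ φ δ₁ δ₂) :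
    SemitransversalWith Ω x₀ φ δ₁ ∧
    ∀ δ₁' δ₂' : ℝ, 0 < δ₁' → δ₁' < δ₁ → 0 < δ₂' → φinv δ₁' + δ₂' ≤ δ₂ →
      SubtransversalWith Ω x₀ φ δ₁' δ₂' := by
  have hx₀' : ∀ i, x₀ ∈ Ω i := fun i => Set.mem_iInter.1 hx₀ i
  refine ⟨?_, ?_⟩
  · intro ρ hρ hρδ x hx
    obtain ⟨z, hz, hzρ⟩ := htr ρ hρ hρδ (fun _ => x₀) x
      (fun i => ⟨hx₀' i, Metric.mem_ball_self hδ₂⟩) hx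
    refine ⟨z + x₀, Set.mem_iInter.2 fun i => ?_, ?_⟩
    · obtain ⟨u, hu, rfl⟩ := Set.mem_iInter.1 hz i
      exact ⟨u, hu, by simp only; abel⟩
    · simpa [dist_eq_norm] using hzρ
  · intro δ₁' δ₂' hδ₁' hδ hδ₂' hsum ρ hρ hρδ x hx hφ
    have hm : 0 ≤ ⨆ i, Metric.infDist x (Ω i) :=
      Real.iSup_nonneg fun i => Metric.infDist_nonneg
    have hlt : (⨆ i, Metric.infDist x (Ω i)) < φinv ρ :=
      (hmono.lt_iff_lt hm (hinvnn ρ hρ.le)).1 (by rwa [hinv₂ ρ hρ.le])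
    have hinvlt : φinv ρ < φinv δ₁' :=
      (hmono.lt_iff_lt (hinvnn ρ hρ.le) (hinvnn δ₁' hδ₁'.le)).1
        (by rwa [hinv₂ ρ hρ.le, hinv₂ δ₁' hδ₁'.le])
    obtain ⟨r, hmr, hr⟩ := exists_between hlt
    have hr0 : 0 ≤ r := hm.trans hmr.le
    have hω : ∀ i, ∃ w ∈ Ω i, dist x w < r := fun i =>
      (Metric.infDist_lt_iff ⟨x₀, hx₀' i⟩).1
        ((le_ciSup (Set.finite_range _).bddAbove i).trans_lt hmr)
    choose ω hωmem hωdist using hω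
    have hsup : (⨆ i, ‖x - ω i‖) ≤ r :=
      Real.iSup_le (fun i => by simpa [dist_eq_norm] using (hωdist i).le) hr0
    have hφlt : φ (⨆ i, ‖x - ω i‖) < ρ := by
      rw [← hinv₂ ρ hρ.le]
      exact hmono (Real.iSup_nonneg fun i => norm_nonneg _) (hinvnn ρ hρ.le)
        (hsup.trans_lt hr)
    obtain ⟨z, hz, hzρ⟩ := htr ρ hρ (hρδ.trans hδ) ω (fun i => x - ω i)
      (fun i => ⟨hωmem i, by
        rw [Metric.mem_ball] at hx ⊢
        have h := dist_triangle_left (ω i) x₀ x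
        linarith [hωdist i]⟩) hφlt
    refine ⟨z + x, Set.mem_iInter.2 fun i => ?_, ?_⟩
    · obtain ⟨u, hu, rfl⟩ := Set.mem_iInter.1 hz i
      simpa using hu
    · simpa [dist_eq_norm] using hzρ
end

section
/- Let X be a normed vector space, Ω₁,…,Ωₙ ⊆ X, x̄ ∈ ⋂ᵢ₌₁ⁿ Ωᵢ, and let φ : [0,∞) → [0,∞) be continuous, strictly increasing, with φ(0) = 0 and φ(t) → ∞ as t → ∞. Suppose ⋂ᵢ₌₁ⁿ Ωᵢ is closed and x̄ belongs to the boundary of ⋂ᵢ₌₁ⁿ Ωᵢ. If {Ω₁,…,Ωₙ} is φ-subtransversal at x̄ with some δ₁ > 0 and δ₂ > 0, then there exists t̄ ∈ (0, min{δ₂, φ⁻¹(δ₁)}] such that φ(t) ≥ t for all t ∈ (0, t̄]. -/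
open Set Filter
open scoped ENNReal

variable {X : Type*} [NormedAddCommGroup X] [NormedSpace ℝ X]

/-- If `⋂ᵢ Ωᵢ` is closed, `x₀` is a boundary point of `⋂ᵢ Ωᵢ`, and `{Ω₁,…,Ωₙ}` is
`φ`-subtransversal at `x₀` with `δ₁, δ₂ > 0`, then there is `t₀ ∈ (0, min{δ₂, φ⁻¹(δ₁)}]`
with `φ(t) ≥ t` for all `t ∈ (0,t₀]`. -/
theorem phi_ge_id_of_subtransversal {n : ℕ} (Ω : Fin n → Set X) (x₀ : X)
    (hx₀ : x₀ ∈ ⋂ i, Ω i)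
    (φ φinv : ℝ → ℝ) (hmono : StrictMonoOn φ (Set.Ici 0)) (hcont : ContinuousOn φ (Set.Ici 0))
    (hzero : φ 0 = 0) (hlim : Tendsto φ atTop atTop)
    (hinv₁ : ∀ t : ℝ, 0 ≤ t → φinv (φ t) = t) (hinv₂ : ∀ t : ℝ, 0 ≤ t → φ (φinv t) = t)
    (hinvnn : ∀ t : ℝ, 0 ≤ t → 0 ≤ φinv t)
    (hcl : IsClosed (⋂ i, Ω i)) (hbd : x₀ ∈ frontier (⋂ i, Ω i))
    (δ₁ δ₂ : ℝ) (hδ₁ : 0 < δ₁) (hδ₂ : 0 < δ₂)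
    (hsub : SubtransversalWith Ω x₀ φ δ₁ δ₂) :
    ∃ t₀ : ℝ, 0 < t₀ ∧ t₀ ≤ min δ₂ (φinv δ₁) ∧ ∀ t : ℝ, 0 < t → t ≤ t₀ → t ≤ φ t := by
  have hinv_pos : 0 < φinv δ₁ := by
    refine lt_of_le_of_ne (hinvnn δ₁ hδ₁.le) fun h => ?_
    have := hinv₂ δ₁ hδ₁.le
    rw [← h, hzero] at this
    exact hδ₁.ne this
  have hne : (⋂ i, Ω i).Nonempty := ⟨x₀, hx₀⟩
  have hr : 0 < min δ₂ (φinv δ₁) := lt_min hδ₂ hinv_pos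
  obtain ⟨x, hxc, hx⟩ := Metric.mem_closure_iff.1
    (frontier_subset_closure ((frontier_compl (⋂ i, Ω i)).symm ▸ hbd)) _ hr
  have hxpos : 0 < Metric.infDist x (⋂ i, Ω i) := (hcl.notMem_iff_infDist_pos hne).1 hxc
  have hxle : Metric.infDist x (⋂ i, Ω i) ≤ dist x₀ x :=
    dist_comm x x₀ ▸ Metric.infDist_le_dist_of_mem hx₀
  refine ⟨_, hxpos, hxle.trans hx.le, fun t ht htx => ?_⟩
  -- the distance to the intersection takes the value `t` on the segment from `x₀` to `x`
  obtain ⟨y, hy, rfl⟩ : ∃ y ∈ segment ℝ x₀ x, Metric.infDist y (⋂ i, Ω i) = t :=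
    (convex_segment x₀ x).isPreconnected.intermediate_value
      (left_mem_segment ℝ x₀ x) (right_mem_segment ℝ x₀ x)
      (Metric.continuous_infDist_pt _).continuousOn
      ⟨(Metric.infDist_zero_of_mem hx₀).trans_le ht.le, htx⟩
  have hyball : y ∈ Metric.ball x₀ δ₂ :=
    (convex_ball x₀ δ₂).segment_subset (Metric.mem_ball_self hδ₂)
      (Metric.mem_ball'.2 (hx.trans_le (min_le_left _ _))) hy
  have hφlt : φ (Metric.infDist y (⋂ i, Ω i)) < δ₁ := by
    rw [← hinv₂ δ₁ hδ₁.le]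
    exact hmono ht.le hinv_pos.le
      (htx.trans_lt (hxle.trans_lt (hx.trans_le (min_le_right _ _))))
  by_contra! hlt
  obtain ⟨ρ, hρ₁, hρ₂⟩ := exists_between (lt_min hlt hφlt)
  have hφpos : 0 < φ (Metric.infDist y (⋂ i, Ω i)) := by
    simpa only [hzero] using hmono self_mem_Ici ht.le ht
  have hsup : φ (⨆ i, Metric.infDist y (Ω i)) ≤ φ (Metric.infDist y (⋂ i, Ω i)) :=
    hmono.monotoneOn (Real.iSup_nonneg fun i => Metric.infDist_nonneg) ht.le
      (Real.iSup_le (fun i => Metric.infDist_le_infDist_of_subset (iInter_subset Ω i) hne) ht.le)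
  obtain ⟨z, hz, hzy⟩ := hsub ρ (hφpos.trans hρ₁) (hρ₂.trans_le (min_le_right _ _)) y hyball
    (hsup.trans_lt hρ₁)
  exact ((Metric.infDist_le_dist_of_mem hz).trans_lt (Metric.mem_ball'.1 hzy)).not_ge
    (hρ₂.trans_le (min_le_left _ _)).le
end

section
/- Let X be a normed vector space, Ω₁,…,Ωₙ ⊆ X, x̄ ∈ ⋂ᵢ₌₁ⁿ Ωᵢ, and let φ : [0,∞) → [0,∞) be continuous, strictly increasing, with φ(0) = 0 and φ(t) → ∞ as t → ∞. Then {Ω₁,…,Ωₙ} is φ-semitransversal at x̄ with some δ > 0 if and only if d(x̄, ⋂ᵢ₌₁ⁿ (Ωᵢ − xᵢ)) ≤ φ(max₁≤i≤n ‖xᵢ‖) for all x₁,…,xₙ ∈ X with φ(max₁≤i≤n ‖xᵢ‖) < δ (in particular ⋂ᵢ₌₁ⁿ (Ωᵢ − xᵢ) is nonempty for such x₁,…,xₙ). -/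
open Set Filter
open scoped ENNReal

variable {X : Type*} [NormedAddCommGroup X] [NormedSpace ℝ X]

/-- `{Ω₁,…,Ωₙ}` is `φ`-semitransversal at `x₀` with `δ > 0` if and only if
`d(x₀, ⋂ᵢ (Ωᵢ − xᵢ)) ≤ φ(maxᵢ ‖xᵢ‖)` for all `xᵢ` with `φ(maxᵢ ‖xᵢ‖) < δ` (the distance
being `+∞` if the intersection is empty, so in particular the intersection is nonempty). -/
theorem semitransversal_iff_metric {n : ℕ} (Ω : Fin n → Set X) (x₀ : X)
    (hx₀ : x₀ ∈ ⋂ i, Ω i)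
    (φ : ℝ → ℝ) (hmono : StrictMonoOn φ (Set.Ici 0)) (hcont : ContinuousOn φ (Set.Ici 0))
    (hzero : φ 0 = 0) (hlim : Tendsto φ atTop atTop)
    (δ : ℝ) (hδ : 0 < δ) :
    SemitransversalWith Ω x₀ φ δ ↔
      ∀ x : Fin n → X, φ (⨆ i, ‖x i‖) < δ →
        EMetric.infEdist x₀ (⋂ i, (fun u => u - x i) '' Ω i)
          ≤ ENNReal.ofReal (φ (⨆ i, ‖x i‖)) := by
  have hnonneg (x : Fin n → X) : 0 ≤ φ (⨆ i, ‖x i‖) := by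
    have h : (0 : ℝ) ≤ ⨆ i, ‖x i‖ := Real.iSup_nonneg fun i => norm_nonneg (x i)
    simpa [hzero] using hmono.monotoneOn (Set.mem_Ici.2 le_rfl) (Set.mem_Ici.2 h) h
  constructor
  · intro h x hx
    refine le_of_forall_gt fun c hc => ?_
    obtain ⟨ρ, hρ, hρc⟩ : ∃ ρ, φ (⨆ i, ‖x i‖) < ρ ∧ ρ < δ ∧ ENNReal.ofReal ρ ≤ c := by
      rcases eq_or_ne c ⊤ with rfl | hc_top
      · obtain ⟨ρ, h₁, h₂⟩ := exists_between hx
        exact ⟨ρ, h₁, h₂, le_top⟩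
      · obtain ⟨ρ, h₁, h₂⟩ := exists_between
          (lt_min hx ((ENNReal.ofReal_lt_iff_lt_toReal (hnonneg x) hc_top).1 hc))
        exact ⟨ρ, h₁, h₂.trans_le (min_le_left _ _),
          ENNReal.ofReal_le_of_le_toReal (h₂.le.trans (min_le_right _ _))⟩
    have hρ_pos : 0 < ρ := (hnonneg x).trans_lt hρ
    obtain ⟨u, hu, hu_ball⟩ := h ρ hρ_pos hρc.1 x hρ
    refine (Metric.infEDist_le_edist_of_mem hu).trans_lt (lt_of_lt_of_le ?_ hρc.2)
    rw [edist_dist, ENNReal.ofReal_lt_ofReal_iff hρ_pos, dist_comm]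
    exact hu_ball
  · intro h ρ hρ hρδ x hx
    have hlt := (h x (hx.trans hρδ)).trans_lt ((ENNReal.ofReal_lt_ofReal_iff hρ).2 hx)
    obtain ⟨u, hu, hu_dist⟩ := Metric.infEDist_lt_iff.1 hlt
    rw [edist_dist, ENNReal.ofReal_lt_ofReal_iff hρ, dist_comm] at hu_dist
    exact ⟨u, hu, hu_dist⟩
end

section
/- Let X be a normed vector space, Ω₁,…,Ωₙ ⊆ X, x̄ ∈ ⋂ᵢ₌₁ⁿ Ωᵢ, let φ : [0,∞) → [0,∞) be continuous, strictly increasing, with φ(0) = 0 and φ(t) → ∞ as t → ∞, and let δ₁ > 0, δ₂ > 0. The following are equivalent: (1) {Ω₁,…,Ωₙ} is φ-subtransversal at x̄ with δ₁ and δ₂; (2) d(x, ⋂ᵢ₌₁ⁿ Ωᵢ) ≤ φ(max₁≤i≤n d(x,Ωᵢ)) for all x ∈ B_{δ₂}(x̄) with φ(max₁≤i≤n d(x,Ωᵢ)) < δ₁; (3) d(0, ⋂ᵢ₌₁ⁿ (Ωᵢ − ωᵢ − xᵢ)) ≤ φ(max₁≤i≤n ‖xᵢ‖) for all x₁,…,xₙ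 ∈ X and ωᵢ ∈ Ωᵢ (i = 1,…,n) with φ(max₁≤i≤n ‖xᵢ‖) < δ₁ and ω₁ + x₁ = ⋯ = ωₙ + xₙ ∈ B_{δ₂}(x̄). -/
open Set Filter
open scoped ENNReal

variable {X : Type*} [NormedAddCommGroup X] [NormedSpace ℝ X]

lemma infEDist_zero_iInter_sub {E : Type*} [NormedAddCommGroup E] {n : ℕ}
    (Ω : Fin n → Set E) (x ω : Fin n → E) (z : E) (hz : ∀ i, ω i + x i = z) :
    Metric.infEDist 0 (⋂ i, (fun u => u - ω i - x i) '' Ω i) =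
      Metric.infEDist z (⋂ i, Ω i) := by
  have himage : (⋂ i, (fun u => u - ω i - x i) '' Ω i) = (fun u => u - z) '' ⋂ i, Ω i := by
    refine Eq.trans ?_ (Set.image_iInter (Equiv.subRight z).bijective _).symm
    refine iInter_congr fun i => image_congr fun u _ => ?_
    rw [sub_sub, hz, Equiv.subRight_apply]
  rw [himage, ← sub_self z]
  exact Metric.infEDist_image (IsometryEquiv.subRight z).isometry

lemma SubtransversalWith.infEDist_le {E : Type*} [NormedAddCommGroup E] {n : ℕ}
    {Ω : Fin n → Set E} {x₀ : E} {φ : ℝ → ℝ} {δ₁ δ₂ : ℝ}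
    (h : SubtransversalWith Ω x₀ φ δ₁ δ₂) {x : E} (hx : x ∈ Metric.ball x₀ δ₂)
    (hnonneg : 0 ≤ φ (⨆ i, Metric.infDist x (Ω i)))
    (hlt : φ (⨆ i, Metric.infDist x (Ω i)) < δ₁) :
    Metric.infEDist x (⋂ i, Ω i) ≤ ENNReal.ofReal (φ (⨆ i, Metric.infDist x (Ω i))) := by
  refine ge_of_tendsto (ENNReal.continuous_ofReal.continuousWithinAt
    (s := Ioi (φ (⨆ i, Metric.infDist x (Ω i))))) ?_
  filter_upwards [Ioo_mem_nhdsGT hlt] with ρ hρ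
  obtain ⟨u, hu, hball⟩ := h ρ (hnonneg.trans_lt hρ.1) hρ.2 x hx hρ.1
  refine (Metric.infEDist_le_edist_of_mem hu).trans ?_
  rw [edist_dist, dist_comm]
  exact ENNReal.ofReal_le_ofReal (Metric.mem_ball.1 hball).le

lemma inter_ball_nonempty_of_infEDist_le {Y : Type*} [PseudoMetricSpace Y] {s : Set Y} {x : Y}
    {r ρ : ℝ} (hρ : 0 < ρ) (h : Metric.infEDist x s ≤ ENNReal.ofReal r) (hr : r < ρ) :
    (s ∩ Metric.ball x ρ).Nonempty := by
  obtain ⟨u, hu, hdist⟩ := Metric.infEDist_lt_iff.1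
    (h.trans_lt ((ENNReal.ofReal_lt_ofReal_iff hρ).2 hr))
  refine ⟨u, hu, ?_⟩
  rw [edist_dist, ENNReal.ofReal_lt_ofReal_iff hρ, dist_comm] at hdist
  exact hdist

/-- Metric characterizations of `φ`-subtransversality: `{Ω₁,…,Ωₙ}` is `φ`-subtransversal
at `x₀` with `δ₁, δ₂` iff (a) `d(x, ⋂ᵢ Ωᵢ) ≤ φ(maxᵢ d(x,Ωᵢ))` for all `x ∈ B_{δ₂}(x₀)`
with `φ(maxᵢ d(x,Ωᵢ)) < δ₁`, and iff (b) `d(0, ⋂ᵢ (Ωᵢ − ωᵢ − xᵢ)) ≤ φ(maxᵢ ‖xᵢ‖)` for all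
`xᵢ ∈ X`, `ωᵢ ∈ Ωᵢ` with `φ(maxᵢ ‖xᵢ‖) < δ₁` and `ω₁ + x₁ = ⋯ = ωₙ + xₙ ∈ B_{δ₂}(x₀)`
(distances to possibly empty sets being `+∞`). -/
theorem subtransversal_iff_metric {n : ℕ} (Ω : Fin n → Set X) (x₀ : X)
    (hx₀ : x₀ ∈ ⋂ i, Ω i)
    (φ : ℝ → ℝ) (hmono : StrictMonoOn φ (Set.Ici 0)) (hcont : ContinuousOn φ (Set.Ici 0))
    (hzero : φ 0 = 0) (hlim : Tendsto φ atTop atTop)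
    (δ₁ δ₂ : ℝ) (hδ₁ : 0 < δ₁) (hδ₂ : 0 < δ₂) :
    (SubtransversalWith Ω x₀ φ δ₁ δ₂ ↔
      ∀ x : X, x ∈ Metric.ball x₀ δ₂ → φ (⨆ i, Metric.infDist x (Ω i)) < δ₁ →
        EMetric.infEdist x (⋂ i, Ω i)
          ≤ ENNReal.ofReal (φ (⨆ i, Metric.infDist x (Ω i)))) ∧
    (SubtransversalWith Ω x₀ φ δ₁ δ₂ ↔
      ∀ (x ω : Fin n → X), (∀ i, ω i ∈ Ω i) → φ (⨆ i, ‖x i‖) < δ₁ →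
        ∀ z : X, z ∈ Metric.ball x₀ δ₂ → (∀ i, ω i + x i = z) →
          EMetric.infEdist 0 (⋂ i, (fun u => u - ω i - x i) '' Ω i)
            ≤ ENNReal.ofReal (φ (⨆ i, ‖x i‖))) := by
  have hsup_dist (x : X) : 0 ≤ ⨆ i, Metric.infDist x (Ω i) :=
    Real.iSup_nonneg fun _ => Metric.infDist_nonneg
  have hφ {t : ℝ} (ht : 0 ≤ t) : 0 ≤ φ t :=
    hzero ▸ hmono.monotoneOn self_mem_Ici ht ht
  refine ⟨⟨fun h x hx hlt => h.infEDist_le hx (hφ (hsup_dist x)) hlt,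
    fun h ρ hρ hρδ x hx hlt =>
      inter_ball_nonempty_of_infEDist_le hρ (h x hx (hlt.trans hρδ)) hlt⟩, ?_, ?_⟩
  · intro h x ω hω hlt z hz hsum
    have hsup_norm : 0 ≤ ⨆ i, ‖x i‖ := Real.iSup_nonneg fun _ => norm_nonneg _
    have hle : φ (⨆ i, Metric.infDist z (Ω i)) ≤ φ (⨆ i, ‖x i‖) := by
      refine hmono.monotoneOn (hsup_dist z) hsup_norm
        (ciSup_mono (finite_range _).bddAbove fun i => ?_)
      refine (Metric.infDist_le_dist_of_mem (hω i)).trans_eq ?_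
      rw [← hsum i, dist_eq_norm, add_sub_cancel_left]
    refine (infEDist_zero_iInter_sub Ω x ω z hsum).trans_le ?_
    exact (h.infEDist_le hz (hφ (hsup_dist z)) (hle.trans_lt hlt)).trans
      (ENNReal.ofReal_le_ofReal hle)
  · intro h ρ hρ hρδ z hz hlt
    obtain ⟨t, ht, htρ⟩ : ∃ t, (⨆ i, Metric.infDist z (Ω i)) < t ∧ φ t < ρ := by
      have hcont' := (hcont _ (hsup_dist z)).mono
        (Ioi_subset_Ici (hsup_dist z) : Ioi (⨆ i, Metric.infDist z (Ω i)) ⊆ Ici 0)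
      exact (eventually_mem_nhdsWithin.and (hcont'.eventually_lt_const hlt)).exists
    have hnear (i) : ∃ u ∈ Ω i, dist z u < t :=
      (Metric.infDist_lt_iff ⟨x₀, mem_iInter.1 hx₀ i⟩).1
        ((le_ciSup (f := fun i => Metric.infDist z (Ω i)) (finite_range _).bddAbove i).trans_lt ht)
    choose ω hω hdist using hnear
    have hle : φ (⨆ i, ‖z - ω i‖) < ρ := by
      have ht0 := (hsup_dist z).trans ht.le
      refine (hmono.monotoneOn (Real.iSup_nonneg fun _ => norm_nonneg _) ht0
        (Real.iSup_le (fun i => ?_) ht0)).trans_lt htρ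
      exact (dist_eq_norm z (ω i)).symm.trans_le (hdist i).le
    have hsum (i) : ω i + (z - ω i) = z := add_sub_cancel _ _
    refine inter_ball_nonempty_of_infEDist_le hρ ?_ hle
    exact (infEDist_zero_iInter_sub Ω _ ω z hsum).symm.trans_le
      (h _ ω hω (hle.trans hρδ) z hz hsum)
end

section
/- Let X be a normed vector space, Ω₁,…,Ωₙ ⊆ X, x̄ ∈ ⋂ᵢ₌₁ⁿ Ωᵢ, let φ : [0,∞) → [0,∞) be continuous, strictly increasing, with φ(0) = 0 and φ(t) → ∞ as t → ∞, and let δ₁ > 0, δ₂ > 0. The following conditions are equivalent: (i) d(0, ⋂ᵢ₌₁ⁿ (Ωᵢ − ωᵢ − xᵢ)) ≤ φ(max₁≤i≤n ‖xᵢ‖) for all xᵢ ∈ X and ωᵢ ∈ Ωᵢ with ωᵢ + xᵢ ∈ B_{δ₂}(x̄) (i = 1,…,n) and φ(max₁≤i≤n ‖xᵢ‖) < δ₁; (ii) d(x̄, ⋂ᵢ₌₁ⁿ (Ωᵢ − xᵢ)) ≤ φ(max₁≤i≤n d(x̄, Ωᵢ − xᵢ)) for all x₁,…,xₙ ∈ δ₂𝔹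 with φ(max₁≤i≤n d(x̄, Ωᵢ − xᵢ)) < δ₁; (iii) d(x, ⋂ᵢ₌₁ⁿ (Ωᵢ − xᵢ)) ≤ φ(max₁≤i≤n d(x, Ωᵢ − xᵢ)) for all x, x₁,…,xₙ ∈ X with x + xᵢ ∈ B_{δ₂}(x̄) (i = 1,…,n) and φ(max₁≤i≤n d(x, Ωᵢ − xᵢ)) < δ₁. Moreover, if {Ω₁,…,Ωₙ} is φ-transversal at x̄ with some δ₁ > 0 and δ₂ > 0, then conditions (i)–(iii) hold with any δ₁' ∈ (0,δ₁] and δ₂' > 0 satisfying φ⁻¹(δ₁') + δ₂' ≤ δ₂ in place of δ₁ and δ₂; conversely, if conditions (i)–(iii) hold with some δ₁ > 0 and δ₂ > 0, then {Ω₁,…,Ωₙ} is φ-transversal at x̄ with any δ₁' ∈ (0,δ₁] and δ₂' > 0 satisfying φ⁻¹(δ₁') + δ₂' ≤ δ₂. -/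
open Set Filter
open scoped ENNReal

variable {X : Type*} [NormedAddCommGroup X] [NormedSpace ℝ X]

/-- Condition (i): `d(0, ⋂ᵢ (Ωᵢ − ωᵢ − xᵢ)) ≤ φ(maxᵢ ‖xᵢ‖)` for all `xᵢ ∈ X`, `ωᵢ ∈ Ωᵢ`
with `ωᵢ + xᵢ ∈ B_{δ₂}(x₀)` and `φ(maxᵢ ‖xᵢ‖) < δ₁`. -/
def MetricCondI {n : ℕ} (Ω : Fin n → Set X) (x₀ : X) (φ : ℝ → ℝ) (δ₁ δ₂ : ℝ) : Prop :=
  ∀ x ω : Fin n → X, (∀ i, ω i ∈ Ω i) → (∀ i, ω i + x i ∈ Metric.ball x₀ δ₂) →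
    φ (⨆ i, ‖x i‖) < δ₁ →
    EMetric.infEdist 0 (⋂ i, (fun u => u - ω i - x i) '' Ω i)
      ≤ ENNReal.ofReal (φ (⨆ i, ‖x i‖))

/-- Condition (ii): `d(x₀, ⋂ᵢ (Ωᵢ − xᵢ)) ≤ φ(maxᵢ d(x₀, Ωᵢ − xᵢ))` for all `xᵢ ∈ δ₂𝔹`
with `φ(maxᵢ d(x₀, Ωᵢ − xᵢ)) < δ₁`. -/
def MetricCondII {n : ℕ} (Ω : Fin n → Set X) (x₀ : X) (φ : ℝ → ℝ) (δ₁ δ₂ : ℝ) : Prop :=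
  ∀ x : Fin n → X, (∀ i, ‖x i‖ < δ₂) →
    φ (⨆ i, Metric.infDist x₀ ((fun u => u - x i) '' Ω i)) < δ₁ →
    EMetric.infEdist x₀ (⋂ i, (fun u => u - x i) '' Ω i)
      ≤ ENNReal.ofReal (φ (⨆ i, Metric.infDist x₀ ((fun u => u - x i) '' Ω i)))

/-- Condition (iii): `d(x, ⋂ᵢ (Ωᵢ − xᵢ)) ≤ φ(maxᵢ d(x, Ωᵢ − xᵢ))` for all `x, xᵢ ∈ X`
with `x + xᵢ ∈ B_{δ₂}(x₀)` and `φ(maxᵢ d(x, Ωᵢ − xᵢ)) < δ₁`. -/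
def MetricCondIII {n : ℕ} (Ω : Fin n → Set X) (x₀ : X) (φ : ℝ → ℝ) (δ₁ δ₂ : ℝ) : Prop :=
  ∀ (x : X) (xs : Fin n → X), (∀ i, x + xs i ∈ Metric.ball x₀ δ₂) →
    φ (⨆ i, Metric.infDist x ((fun u => u - xs i) '' Ω i)) < δ₁ →
    EMetric.infEdist x (⋂ i, (fun u => u - xs i) '' Ω i)
      ≤ ENNReal.ofReal (φ (⨆ i, Metric.infDist x ((fun u => u - xs i) '' Ω i)))

theorem infEDist_iInter_image_sub_eq {E : Type*} [NormedAddCommGroup E]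
    {n : ℕ} (Ω : Fin n → Set E) {x : E} {a b c : Fin n → E}
    (h : ∀ i, x + a i = b i + c i) :
    Metric.infEDist x (⋂ i, (fun u => u - a i) '' Ω i) =
      Metric.infEDist 0 (⋂ i, (fun u => u - b i - c i) '' Ω i) := by
  have hset : (⋂ i, (fun u => u - b i - c i) '' Ω i) =
      (fun v => v - x) '' (⋂ i, (fun u => u - a i) '' Ω i) := by
    ext v
    simp only [mem_iInter, mem_image]
    constructor
    · intro hv
      refine ⟨v + x, fun i => ?_, by abel⟩
      obtain ⟨u, hu, rfl⟩ := hv i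
      refine ⟨u, hu, ?_⟩
      rw [sub_sub, ← h i]
      abel
    · rintro ⟨w, hw, rfl⟩ i
      obtain ⟨u, hu, rfl⟩ := hw i
      refine ⟨u, hu, ?_⟩
      rw [sub_sub, ← h i]
      abel
  have hiso : Isometry (fun v : E => v - x) := (IsometryEquiv.subRight x).isometry
  rw [hset, ← Metric.infEDist_image hiso, sub_self]

theorem MetricCondI.metricCondIII {E : Type*} [NormedAddCommGroup E]
    {n : ℕ} {Ω : Fin n → Set E} {φ : ℝ → ℝ} {x₀ : E} {δ₁ δ₂ : ℝ}
    (hne : ∀ i, (Ω i).Nonempty) (hmono : MonotoneOn φ (Ici 0)) (hcont : ContinuousOn φ (Ici 0))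
    (hI : MetricCondI Ω x₀ φ δ₁ δ₂) : MetricCondIII Ω x₀ φ δ₁ δ₂ := by
  intro x xs hxs hφ
  set M := ⨆ i, Metric.infDist x ((fun u => u - xs i) '' Ω i) with hM
  have hM0 : 0 ≤ M := Real.iSup_nonneg fun _ => Metric.infDist_nonneg
  have hlim : Tendsto φ (nhdsWithin M (Ioi M)) (nhds (φ M)) :=
    (hcont M hM0).mono fun y hy => hM0.trans (le_of_lt hy)
  refine ge_of_tendsto (ENNReal.tendsto_ofReal hlim) ?_
  filter_upwards [hlim.eventually_lt_const hφ, self_mem_nhdsWithin] with r hr hMr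
  have hω : ∀ i, ∃ ω ∈ Ω i, ‖x + xs i - ω‖ < r := by
    intro i
    have hi : Metric.infDist x ((fun u => u - xs i) '' Ω i) < r :=
      (le_ciSup (f := fun i => Metric.infDist x ((fun u => u - xs i) '' Ω i))
        (Set.finite_range _).bddAbove i).trans_lt hMr
    obtain ⟨_, ⟨ω, hω, rfl⟩, hd⟩ := (Metric.infDist_lt_iff ((hne i).image _)).1 hi
    refine ⟨ω, hω, ?_⟩
    rwa [dist_eq_norm, ← sub_add, sub_add_eq_add_sub] at hd
  choose ω hωΩ hωr using hω
  have hr0 : 0 ≤ r := hM0.trans (le_of_lt hMr)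
  have hle : φ (⨆ i, ‖x + xs i - ω i‖) ≤ φ r :=
    hmono (Real.iSup_nonneg fun _ => norm_nonneg _) hr0
      (Real.iSup_le (fun i => (hωr i).le) hr0)
  have key := hI (fun i => x + xs i - ω i) ω hωΩ (fun i => by simpa using hxs i)
    (hle.trans_lt hr)
  refine (infEDist_iInter_image_sub_eq Ω fun i => ?_).trans_le
    (key.trans (ENNReal.ofReal_le_ofReal hle))
  abel

theorem MetricCondIII.metricCondII {E : Type*} [NormedAddCommGroup E]
    {n : ℕ} {Ω : Fin n → Set E} {φ : ℝ → ℝ} {x₀ : E} {δ₁ δ₂ : ℝ}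
    (hIII : MetricCondIII Ω x₀ φ δ₁ δ₂) : MetricCondII Ω x₀ φ δ₁ δ₂ :=
  fun x hx hφ => hIII x₀ x (fun i => by simpa using hx i) hφ

theorem MetricCondII.metricCondI {E : Type*} [NormedAddCommGroup E]
    {n : ℕ} {Ω : Fin n → Set E} {φ : ℝ → ℝ} {x₀ : E} {δ₁ δ₂ : ℝ}
    (hmono : MonotoneOn φ (Ici 0)) (hII : MetricCondII Ω x₀ φ δ₁ δ₂) :
    MetricCondI Ω x₀ φ δ₁ δ₂ := by
  intro x ω hω hball hφ
  have hle : φ (⨆ i, Metric.infDist x₀ ((fun u => u - (ω i + x i - x₀)) '' Ω i)) ≤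
      φ (⨆ i, ‖x i‖) := by
    refine hmono (Real.iSup_nonneg fun _ => Metric.infDist_nonneg)
      (Real.iSup_nonneg fun _ => norm_nonneg _)
      (Real.iSup_le (fun i => ?_) (Real.iSup_nonneg fun _ => norm_nonneg _))
    calc Metric.infDist x₀ ((fun u => u - (ω i + x i - x₀)) '' Ω i)
        ≤ dist x₀ (ω i - (ω i + x i - x₀)) :=
          Metric.infDist_le_dist_of_mem (mem_image_of_mem _ (hω i))
      _ = ‖x i‖ := by rw [dist_eq_norm]; congr 1; abel
      _ ≤ ⨆ i, ‖x i‖ := le_ciSup (f := fun i => ‖x i‖) (Set.finite_range _).bddAbove i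
  have key := hII (fun i => ω i + x i - x₀) (fun i => by simpa [dist_eq_norm] using hball i)
    (hle.trans_lt hφ)
  refine (infEDist_iInter_image_sub_eq Ω fun i => ?_).symm.trans_le
    (key.trans (ENNReal.ofReal_le_ofReal hle))
  abel

theorem TransversalWith.metricCondI {E : Type*} [NormedAddCommGroup E]
    {n : ℕ} {Ω : Fin n → Set E} {φ : ℝ → ℝ} {x₀ : E}
    {δ₁ δ₂ δ₁' δ₂' t : ℝ} (hmono : StrictMonoOn φ (Ici 0)) (hzero : φ 0 = 0) (ht : 0 ≤ t)
    (hφt : φ t = δ₁') (hδ₁' : δ₁' ≤ δ₁) (hδ₂' : t + δ₂' ≤ δ₂)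
    (hT : TransversalWith Ω x₀ φ δ₁ δ₂) : MetricCondI Ω x₀ φ δ₁' δ₂' := by
  intro x ω hω hball hφ
  have hM0 : 0 ≤ ⨆ i, ‖x i‖ := Real.iSup_nonneg fun _ => norm_nonneg _
  have hφ0 : 0 ≤ φ (⨆ i, ‖x i‖) := hzero ▸ hmono.monotoneOn self_mem_Ici hM0 hM0
  have hMt : ⨆ i, ‖x i‖ < t := (hmono.lt_iff_lt hM0 ht).1 (hφt ▸ hφ)
  have hωball : ∀ i, ω i ∈ Ω i ∩ Metric.ball x₀ δ₂ := by
    refine fun i => ⟨hω i, ?_⟩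
    have hi : ‖x i‖ ≤ ⨆ i, ‖x i‖ :=
      le_ciSup (f := fun i => ‖x i‖) (Set.finite_range _).bddAbove i
    have hb : dist (ω i + x i) x₀ < δ₂' := hball i
    have htri := dist_triangle (ω i) (ω i + x i) x₀
    rw [dist_self_add_right] at htri
    rw [Metric.mem_ball]
    linarith
  have hlim : Tendsto ENNReal.ofReal (nhdsWithin (φ (⨆ i, ‖x i‖)) (Ioi (φ (⨆ i, ‖x i‖))))
      (nhds (ENNReal.ofReal (φ (⨆ i, ‖x i‖)))) :=
    ENNReal.tendsto_ofReal (tendsto_id.mono_left nhdsWithin_le_nhds)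
  refine ge_of_tendsto hlim ?_
  filter_upwards [Ioo_mem_nhdsGT (hφ.trans_le hδ₁')] with ρ hρ
  obtain ⟨z, hz, hzρ⟩ := hT ρ (hφ0.trans_lt hρ.1) hρ.2 ω x hωball hρ.1
  refine (Metric.infEDist_le_edist_of_mem hz).trans ?_
  rw [edist_dist, dist_comm]
  exact ENNReal.ofReal_le_ofReal (Metric.mem_ball.1 hzρ).le

theorem MetricCondI.transversalWith {E : Type*} [NormedAddCommGroup E]
    {n : ℕ} {Ω : Fin n → Set E} {φ : ℝ → ℝ} {x₀ : E}
    {δ₁ δ₂ δ₁' δ₂' t : ℝ} (hmono : StrictMonoOn φ (Ici 0)) (ht : 0 ≤ t)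
    (hφt : φ t = δ₁') (hδ₁' : δ₁' ≤ δ₁) (hδ₂' : t + δ₂' ≤ δ₂)
    (hI : MetricCondI Ω x₀ φ δ₁ δ₂) : TransversalWith Ω x₀ φ δ₁' δ₂' := by
  intro ρ hρ0 hρ ω x hω hφ
  have hM0 : 0 ≤ ⨆ i, ‖x i‖ := Real.iSup_nonneg fun _ => norm_nonneg _
  have hMt : ⨆ i, ‖x i‖ < t := (hmono.lt_iff_lt hM0 ht).1 (hφt ▸ hφ.trans hρ)
  have hball : ∀ i, ω i + x i ∈ Metric.ball x₀ δ₂ := by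
    intro i
    have hi : ‖x i‖ ≤ ⨆ i, ‖x i‖ :=
      le_ciSup (f := fun i => ‖x i‖) (Set.finite_range _).bddAbove i
    have hb : dist (ω i) x₀ < δ₂' := (hω i).2
    have htri := dist_triangle (ω i + x i) (ω i) x₀
    rw [dist_self_add_left] at htri
    rw [Metric.mem_ball]
    linarith
  have hlt := (hI x ω (fun i => (hω i).1) hball ((hφ.trans hρ).trans_le hδ₁')).trans_lt
    ((ENNReal.ofReal_lt_ofReal_iff hρ0).2 hφ)
  obtain ⟨z, hz, hzρ⟩ := Metric.infEDist_lt_iff.1 hlt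
  refine ⟨z, hz, ?_⟩
  rw [edist_dist, ENNReal.ofReal_lt_ofReal_iff hρ0, dist_comm] at hzρ
  exact hzρ

/-- Conditions (i)–(iii) are equivalent; moreover, `φ`-transversality with `δ₁, δ₂`
implies (i)–(iii) with any `δ₁' ∈ (0,δ₁]`, `δ₂' > 0` satisfying `φ⁻¹(δ₁') + δ₂' ≤ δ₂`,
and conversely (i)–(iii) with `δ₁, δ₂` imply `φ`-transversality with any such
`δ₁', δ₂'`. -/
theorem transversal_alternative_metric {n : ℕ} (Ω : Fin n → Set X) (x₀ : X)
    (hx₀ : x₀ ∈ ⋂ i, Ω i)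
    (φ φinv : ℝ → ℝ) (hmono : StrictMonoOn φ (Set.Ici 0)) (hcont : ContinuousOn φ (Set.Ici 0))
    (hzero : φ 0 = 0) (hlim : Tendsto φ atTop atTop)
    (hinv₁ : ∀ t : ℝ, 0 ≤ t → φinv (φ t) = t) (hinv₂ : ∀ t : ℝ, 0 ≤ t → φ (φinv t) = t)
    (hinvnn : ∀ t : ℝ, 0 ≤ t → 0 ≤ φinv t)
    (δ₁ δ₂ : ℝ) (hδ₁ : 0 < δ₁) (hδ₂ : 0 < δ₂) :
    (MetricCondI Ω x₀ φ δ₁ δ₂ ↔ MetricCondII Ω x₀ φ δ₁ δ₂) ∧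
    (MetricCondI Ω x₀ φ δ₁ δ₂ ↔ MetricCondIII Ω x₀ φ δ₁ δ₂) ∧
    (TransversalWith Ω x₀ φ δ₁ δ₂ →
      ∀ δ₁' δ₂' : ℝ, 0 < δ₁' → δ₁' ≤ δ₁ → 0 < δ₂' → φinv δ₁' + δ₂' ≤ δ₂ →
        MetricCondI Ω x₀ φ δ₁' δ₂' ∧ MetricCondII Ω x₀ φ δ₁' δ₂' ∧
          MetricCondIII Ω x₀ φ δ₁' δ₂') ∧
    (MetricCondI Ω x₀ φ δ₁ δ₂ →
      ∀ δ₁' δ₂' : ℝ, 0 < δ₁' → δ₁' ≤ δ₁ → 0 < δ₂' → φinv δ₁' + δ₂' ≤ δ₂ →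
        TransversalWith Ω x₀ φ δ₁' δ₂') := by
  have hne : ∀ i, (Ω i).Nonempty := fun i => ⟨x₀, mem_iInter.1 hx₀ i⟩
  have hm := hmono.monotoneOn
  refine ⟨⟨fun h => (h.metricCondIII hne hm hcont).metricCondII, fun h => h.metricCondI hm⟩,
    ⟨fun h => h.metricCondIII hne hm hcont, fun h => h.metricCondII.metricCondI hm⟩, ?_, ?_⟩
  · intro hT δ₁' δ₂' hpos hle _ hδ
    have hI := hT.metricCondI hmono hzero (hinvnn δ₁' hpos.le) (hinv₂ δ₁' hpos.le) hle hδ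
    have hIII := hI.metricCondIII hne hm hcont
    exact ⟨hI, hIII.metricCondII, hIII⟩
  · intro hI δ₁' δ₂' hpos hle _ hδ
    exact hI.transversalWith hmono (hinvnn δ₁' hpos.le) (hinv₂ δ₁' hpos.le) hle hδ
end

section
/- Let Ω₁, Ω₂ be subsets of a normed vector space X, x̄ ∈ Ω₁ ∩ Ω₂, let φ : [0,∞) → [0,∞) be continuous, strictly increasing, with φ(0) = 0 and φ(t) → ∞ as t → ∞, and let α > 0, t̄ > 0 satisfy φ(t) ≤ αt for all t ∈ (0, t̄]. Set α' := (1+2α)⁻¹. If d(x̄, (Ω₁ − x) ∩ Ω₂) ≤ φ(‖x‖) for all x ∈ t̄𝔹, then {Ω₁, Ω₂} is α'-semitransversal (of order 1) at x̄ with δ := (α + 1/2)·t̄, i.e. (Ω₁ − x₁) ∩ (Ω₂ − x₂) ∩ B_ρ(x̄) ≠ ∅ for all ρ ∈ (0,δ) and all x₁, x₂ ∈ X with max{‖x₁‖,‖x₂‖} < α'ρ. -/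
open Set Filter
open scoped ENNReal

/-- Proposition 3.2(i): if `φ(t) ≤ αt` on `(0,t₀]` and
`d(x₀, (Ω₁ − x) ∩ Ω₂) ≤ φ(‖x‖)` for all `x ∈ t₀𝔹`, then `{Ω₁,Ω₂}` is
`α'`-semitransversal (of order 1) at `x₀` with `δ = (α + 1/2)t₀`, where
`α' = (1 + 2α)⁻¹`: i.e. `(Ω₁ − x₁) ∩ (Ω₂ − x₂) ∩ B_ρ(x₀) ≠ ∅` for all `ρ ∈ (0,δ)`
and `x₁, x₂` with `max{‖x₁‖,‖x₂‖} < α'ρ`. -/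
theorem semitransversal_of_restricted_estimate {X : Type*} [NormedAddCommGroup X]
    [NormedSpace ℝ X] (Ω₁ Ω₂ : Set X) (x₀ : X) (hx₀ : x₀ ∈ Ω₁ ∩ Ω₂)
    (φ : ℝ → ℝ) (hmono : StrictMonoOn φ (Set.Ici 0)) (hcont : ContinuousOn φ (Set.Ici 0))
    (hzero : φ 0 = 0) (hlim : Tendsto φ atTop atTop)
    (α t₀ : ℝ) (hα : 0 < α) (ht₀ : 0 < t₀)
    (hφα : ∀ t : ℝ, 0 < t → t ≤ t₀ → φ t ≤ α * t)
    (H : ∀ x : X, ‖x‖ < t₀ →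
      EMetric.infEdist x₀ (((fun u => u - x) '' Ω₁) ∩ Ω₂) ≤ ENNReal.ofReal (φ ‖x‖)) :
    ∀ ρ : ℝ, 0 < ρ → ρ < (α + 1 / 2) * t₀ → ∀ x₁ x₂ : X,
      max ‖x₁‖ ‖x₂‖ < (1 + 2 * α)⁻¹ * ρ →
      (((fun u => u - x₁) '' Ω₁) ∩ ((fun u => u - x₂) '' Ω₂) ∩ Metric.ball x₀ ρ).Nonempty := by
  intro ρ _ hρδ x₁ x₂ hmax
  set M := max ‖x₁‖ ‖x₂‖
  have h₁ : ‖x₁‖ ≤ M := le_max_left _ _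
  have h₂ : ‖x₂‖ ≤ M := le_max_right _ _
  have hM : (1 + 2 * α) * M < ρ := by
    rwa [inv_mul_eq_div, lt_div_iff₀' (by positivity)] at hmax
  have hsub : ‖x₁ - x₂‖ ≤ 2 * M := (norm_sub_le _ _).trans (by linarith)
  have hlt : ‖x₁ - x₂‖ < t₀ := by
    have : M < t₀ / 2 := by
      refine lt_of_mul_lt_mul_left (a := 1 + 2 * α) ?_ (by positivity)
      linarith
    linarith
  have hφle : φ ‖x₁ - x₂‖ ≤ α * ‖x₁ - x₂‖ := by
    rcases (norm_nonneg (x₁ - x₂)).eq_or_lt with h | h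
    · simp [← h, hzero]
    · exact hφα _ h hlt.le
  have hφlt : φ ‖x₁ - x₂‖ < ρ - M := by
    have := mul_le_mul_of_nonneg_left hsub hα.le
    linarith
  have hpos : 0 < ρ - M := by
    have : 0 ≤ α * M := mul_nonneg hα.le ((norm_nonneg _).trans h₁)
    linarith
  have hdist := (H _ hlt).trans_lt ((ENNReal.ofReal_lt_ofReal_iff hpos).2 hφlt)
  obtain ⟨z, ⟨⟨u, hu, huz⟩, hz⟩, hzd⟩ := Metric.infEDist_lt_iff.1 hdist
  rw [edist_dist, ENNReal.ofReal_lt_ofReal_iff hpos, dist_comm, dist_eq_norm] at hzd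
  refine ⟨z - x₂, ⟨⟨u, hu, ?_⟩, z, hz, rfl⟩, ?_⟩
  · simp only [← huz]
    abel
  · rw [Metric.mem_ball, dist_eq_norm, sub_right_comm]
    exact (norm_sub_le _ _).trans_lt (by linarith)
end

section
/- Let Ω₁, Ω₂ be subsets of a normed vector space X, x̄ ∈ Ω₁ ∩ Ω₂, let φ : [0,∞) → [0,∞) be continuous, strictly increasing, with φ(0) = 0 and φ(t) → ∞ as t → ∞, and let α > 0, t̄ > 0 satisfy φ(t) ≤ αt for all t ∈ (0, t̄]. Set α' := (1+2α)⁻¹. If there exists δ₂ > 0 such that d(x, Ω₁ ∩ Ω₂) ≤ φ(d(x, Ω₁)) for all x ∈ Ω₂ ∩ B_{2δ₂}(x̄) with d(x, Ω₁) < t̄, then {Ω₁, Ω₂} is α'-subtransversal (of order 1) at x̄ with δ₁ := (α + 1/2)·t̄ and δ₂, i.e. Ω₁ ∩ Ω₂ ∩ B_ρ(x) ≠ ∅ for all ρ ∈ (0,δ₁) and all x ∈ B_{δ₂}(x̄) with max{d(x,Ω₁), d(x,Ω₂)} < α'ρ. -/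
open Set Filter
open scoped ENNReal

/-- Proposition 3.2(ii): if `φ(t) ≤ αt` on `(0,t₀]` and, for some `δ₂ > 0`,
`d(x, Ω₁ ∩ Ω₂) ≤ φ(d(x,Ω₁))` for all `x ∈ Ω₂ ∩ B_{2δ₂}(x₀)` with `d(x,Ω₁) < t₀`,
then `{Ω₁,Ω₂}` is `α'`-subtransversal (of order 1) at `x₀` with `δ₁ = (α + 1/2)t₀`
and `δ₂`, where `α' = (1 + 2α)⁻¹`: i.e. `Ω₁ ∩ Ω₂ ∩ B_ρ(x) ≠ ∅` for all `ρ ∈ (0,δ₁)`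
and `x ∈ B_{δ₂}(x₀)` with `max{d(x,Ω₁), d(x,Ω₂)} < α'ρ`. -/
theorem subtransversal_of_restricted_estimate {X : Type*} [NormedAddCommGroup X]
    [NormedSpace ℝ X] (Ω₁ Ω₂ : Set X) (x₀ : X) (hx₀ : x₀ ∈ Ω₁ ∩ Ω₂)
    (φ : ℝ → ℝ) (hmono : StrictMonoOn φ (Set.Ici 0)) (hcont : ContinuousOn φ (Set.Ici 0))
    (hzero : φ 0 = 0) (hlim : Tendsto φ atTop atTop)
    (α t₀ : ℝ) (hα : 0 < α) (ht₀ : 0 < t₀)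
    (hφα : ∀ t : ℝ, 0 < t → t ≤ t₀ → φ t ≤ α * t) :
    ∀ δ₂ : ℝ, 0 < δ₂ →
      (∀ x ∈ Ω₂ ∩ Metric.ball x₀ (2 * δ₂), Metric.infDist x Ω₁ < t₀ →
        EMetric.infEdist x (Ω₁ ∩ Ω₂) ≤ ENNReal.ofReal (φ (Metric.infDist x Ω₁))) →
      ∀ ρ : ℝ, 0 < ρ → ρ < (α + 1 / 2) * t₀ → ∀ x ∈ Metric.ball x₀ δ₂,
        max (Metric.infDist x Ω₁) (Metric.infDist x Ω₂) < (1 + 2 * α)⁻¹ * ρ →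
        (Ω₁ ∩ Ω₂ ∩ Metric.ball x ρ).Nonempty := by
  intro δ₂ _ hest ρ hρ hρδ x hx hmax
  obtain ⟨h₁, h₂⟩ := max_lt_iff.mp hmax
  set β := (1 + 2 * α)⁻¹ with hβ
  have hβmul : β * (1 + 2 * α) = 1 := inv_mul_cancel₀ (by positivity)
  have hβpos : 0 < β := by positivity
  have hxδ : Metric.infDist x Ω₂ < δ₂ :=
    (Metric.infDist_le_dist_of_mem hx₀.2).trans_lt hx
  obtain ⟨y, hy, hxy⟩ := (Metric.infDist_lt_iff ⟨x₀, hx₀.2⟩).mp (lt_min h₂ hxδ)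
  obtain ⟨hxyρ, hxyδ⟩ := lt_min_iff.mp hxy
  have hyball : y ∈ Metric.ball x₀ (2 * δ₂) := by
    rw [Metric.mem_ball] at hx ⊢
    linarith [dist_triangle_left y x₀ x]
  have hyρ : Metric.infDist y Ω₁ < 2 * (β * ρ) := by
    have := Metric.infDist_le_infDist_add_dist (s := Ω₁) (x := y) (y := x)
    rw [dist_comm] at this
    linarith
  have hyt : Metric.infDist y Ω₁ < t₀ := by
    have h := mul_lt_mul_of_pos_left hρδ hβpos
    have : β * ((α + 1 / 2) * t₀) = t₀ / 2 := by linear_combination t₀ / 2 * hβmul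
    linarith
  have hφy : φ (Metric.infDist y Ω₁) ≤ α * Metric.infDist y Ω₁ := by
    rcases (Metric.infDist_nonneg (x := y) (s := Ω₁)).eq_or_lt with h | h
    · rw [← h, hzero, mul_zero]
    · exact hφα _ h hyt.le
  have hlt : Metric.infEDist y (Ω₁ ∩ Ω₂) < ENNReal.ofReal (α * (2 * (β * ρ))) :=
    (hest y ⟨hy, hyball⟩ hyt).trans_lt <|
      (ENNReal.ofReal_lt_ofReal_iff (by positivity)).mpr <|
        hφy.trans_lt (mul_lt_mul_of_pos_left hyρ hα)
  obtain ⟨z, hz, hyz⟩ := Metric.infEDist_lt_iff.mp hlt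
  rw [edist_lt_ofReal] at hyz
  refine ⟨z, hz, ?_⟩
  rw [Metric.mem_ball']
  calc dist x z ≤ dist x y + dist y z := dist_triangle x y z
    _ < β * ρ + α * (2 * (β * ρ)) := add_lt_add hxyρ hyz
    _ = ρ := by linear_combination ρ * hβmul
end

section
/- Let X be a normed vector space, Ω₁,…,Ωₙ ⊆ X, x̄ ∈ ⋂ᵢ₌₁ⁿ Ωᵢ, let φ : [0,∞) → [0,∞) be continuous, strictly increasing, with φ(0) = 0 and φ(t) → ∞ as t → ∞, and let x ∈ X be fixed. The following conditions are equivalent: (i) d(x, ⋂ᵢ₌₁ⁿ Ωᵢ) ≤ φ(max₁≤i≤n d(x,Ωᵢ)); (ii) d(x, ⋂ᵢ₌₁ⁿ Ωᵢ) ≤ φ(max₁≤i≤n ‖x − ωᵢ‖) for all ωᵢ ∈ Ωᵢ (i = 1,…,n); (iii) d(x, ⋂ᵢ₌₁ⁿ Ωᵢ) ≤ φ(max₁≤i≤n ‖x − ωᵢ‖) for all ωᵢ ∈ Ωᵢ with ‖ωᵢ − x̄‖ < ‖x − x̄‖ + φ⁻¹(‖x − x̄‖) (i = 1,…,n); (iv)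 d(x, ⋂ᵢ₌₁ⁿ Ωᵢ) ≤ φ(max₁≤i≤n ‖x − ωᵢ‖) for all ωᵢ ∈ Ωᵢ with φ(‖ωᵢ − x‖) < ‖x − x̄‖ (i = 1,…,n). -/
open Set Filter
open scoped ENNReal

/-- Proposition 3.3: for fixed `x`, the estimate `d(x, ⋂ᵢ Ωᵢ) ≤ φ(maxᵢ d(x,Ωᵢ))` is
equivalent to each of the following: the inequality
`d(x, ⋂ᵢ Ωᵢ) ≤ φ(maxᵢ ‖x − ωᵢ‖)` holding (ii) for all `ωᵢ ∈ Ωᵢ`; (iii) for all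
`ωᵢ ∈ Ωᵢ` with `‖ωᵢ − x₀‖ < ‖x − x₀‖ + φ⁻¹(‖x − x₀‖)`; (iv) for all `ωᵢ ∈ Ωᵢ` with
`φ(‖ωᵢ − x‖) < ‖x − x₀‖` (the distance to a possibly empty intersection being `+∞`). -/
theorem metric_estimate_equivalences {X : Type*} [NormedAddCommGroup X] [NormedSpace ℝ X]
    {n : ℕ} (Ω : Fin n → Set X) (x₀ : X) (hx₀ : x₀ ∈ ⋂ i, Ω i)
    (φ φinv : ℝ → ℝ) (hmono : StrictMonoOn φ (Set.Ici 0)) (hcont : ContinuousOn φ (Set.Ici 0))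
    (hzero : φ 0 = 0) (hlim : Tendsto φ atTop atTop)
    (hinv₁ : ∀ t : ℝ, 0 ≤ t → φinv (φ t) = t) (hinv₂ : ∀ t : ℝ, 0 ≤ t → φ (φinv t) = t)
    (hinvnn : ∀ t : ℝ, 0 ≤ t → 0 ≤ φinv t)
    (x : X) :
    ((EMetric.infEdist x (⋂ i, Ω i)
        ≤ ENNReal.ofReal (φ (⨆ i, Metric.infDist x (Ω i)))) ↔
      (∀ ω : Fin n → X, (∀ i, ω i ∈ Ω i) →
        EMetric.infEdist x (⋂ i, Ω i) ≤ ENNReal.ofReal (φ (⨆ i, ‖x - ω i‖)))) ∧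
    ((∀ ω : Fin n → X, (∀ i, ω i ∈ Ω i) →
        EMetric.infEdist x (⋂ i, Ω i) ≤ ENNReal.ofReal (φ (⨆ i, ‖x - ω i‖))) ↔
      (∀ ω : Fin n → X, (∀ i, ω i ∈ Ω i) →
        (∀ i, ‖ω i - x₀‖ < ‖x - x₀‖ + φinv ‖x - x₀‖) →
        EMetric.infEdist x (⋂ i, Ω i) ≤ ENNReal.ofReal (φ (⨆ i, ‖x - ω i‖)))) ∧
    ((∀ ω : Fin n → X, (∀ i, ω i ∈ Ω i) →
        (∀ i, ‖ω i - x₀‖ < ‖x - x₀‖ + φinv ‖x - x₀‖) →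
        EMetric.infEdist x (⋂ i, Ω i) ≤ ENNReal.ofReal (φ (⨆ i, ‖x - ω i‖))) ↔
      (∀ ω : Fin n → X, (∀ i, ω i ∈ Ω i) →
        (∀ i, φ ‖ω i - x‖ < ‖x - x₀‖) →
        EMetric.infEdist x (⋂ i, Ω i) ≤ ENNReal.ofReal (φ (⨆ i, ‖x - ω i‖)))) := by
  have mono : ∀ {a b : ℝ}, 0 ≤ a → a ≤ b → φ a ≤ φ b := fun ha hab =>
    hmono.monotoneOn (Set.mem_Ici.2 ha) (Set.mem_Ici.2 (ha.trans hab)) hab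
  have all_of_infDist : (EMetric.infEdist x (⋂ i, Ω i)
        ≤ ENNReal.ofReal (φ (⨆ i, Metric.infDist x (Ω i)))) →
      (∀ ω : Fin n → X, (∀ i, ω i ∈ Ω i) →
        EMetric.infEdist x (⋂ i, Ω i) ≤ ENNReal.ofReal (φ (⨆ i, ‖x - ω i‖))) := by
    intro h ω hω
    refine h.trans (ENNReal.ofReal_le_ofReal (mono ?_ ?_))
    · exact Real.iSup_nonneg fun i => Metric.infDist_nonneg
    · refine ciSup_mono (Set.finite_range _).bddAbove fun i => ?_
      rw [← dist_eq_norm]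
      exact Metric.infDist_le_dist_of_mem (hω i)
  have infDist_of_all : (∀ ω : Fin n → X, (∀ i, ω i ∈ Ω i) →
        EMetric.infEdist x (⋂ i, Ω i) ≤ ENNReal.ofReal (φ (⨆ i, ‖x - ω i‖))) →
      EMetric.infEdist x (⋂ i, Ω i)
        ≤ ENNReal.ofReal (φ (⨆ i, Metric.infDist x (Ω i))) := by
    intro h
    set s := ⨆ i, Metric.infDist x (Ω i)
    have hs0 : 0 ≤ s := Real.iSup_nonneg fun i => Metric.infDist_nonneg
    have hlim_s : Tendsto (fun t => ENNReal.ofReal (φ t)) (nhdsWithin s (Set.Ioi s))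
        (nhds (ENNReal.ofReal (φ s))) :=
      (ENNReal.continuous_ofReal.tendsto _).comp
        ((hcont s hs0).mono fun t ht => hs0.trans (le_of_lt ht))
    refine ge_of_tendsto hlim_s ?_
    filter_upwards [self_mem_nhdsWithin] with t ht
    have hst : s < t := ht
    have hex : ∀ i, ∃ w ∈ Ω i, dist x w < t := fun i =>
      (Metric.infDist_lt_iff ⟨x₀, Set.mem_iInter.1 hx₀ i⟩).1
        ((le_ciSup (Set.finite_range fun i => Metric.infDist x (Ω i)).bddAbove i).trans_lt hst)
    choose ω hω hd using hex
    refine (h ω hω).trans (ENNReal.ofReal_le_ofReal (mono ?_ ?_))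
    · exact Real.iSup_nonneg fun i => norm_nonneg _
    · refine Real.iSup_le (fun i => ?_) (hs0.trans hst.le)
      rw [← dist_eq_norm]
      exact (hd i).le
  have near_point_of_near_base : (∀ ω : Fin n → X, (∀ i, ω i ∈ Ω i) →
        (∀ i, ‖ω i - x₀‖ < ‖x - x₀‖ + φinv ‖x - x₀‖) →
        EMetric.infEdist x (⋂ i, Ω i) ≤ ENNReal.ofReal (φ (⨆ i, ‖x - ω i‖))) →
      (∀ ω : Fin n → X, (∀ i, ω i ∈ Ω i) →
        (∀ i, φ ‖ω i - x‖ < ‖x - x₀‖) →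
        EMetric.infEdist x (⋂ i, Ω i) ≤ ENNReal.ofReal (φ (⨆ i, ‖x - ω i‖))) := by
    intro h ω hω hφ
    refine h ω hω fun i => ?_
    have hlt : ‖ω i - x‖ < φinv ‖x - x₀‖ := by
      by_contra! hle
      have := mono (hinvnn _ (norm_nonneg _)) hle
      rw [hinv₂ _ (norm_nonneg _)] at this
      exact absurd (hφ i) this.not_gt
    linarith [norm_sub_le_norm_sub_add_norm_sub (ω i) x x₀]
  have all_of_near_point : (∀ ω : Fin n → X, (∀ i, ω i ∈ Ω i) →
        (∀ i, φ ‖ω i - x‖ < ‖x - x₀‖) →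
        EMetric.infEdist x (⋂ i, Ω i) ≤ ENNReal.ofReal (φ (⨆ i, ‖x - ω i‖))) →
      (∀ ω : Fin n → X, (∀ i, ω i ∈ Ω i) →
        EMetric.infEdist x (⋂ i, Ω i) ≤ ENNReal.ofReal (φ (⨆ i, ‖x - ω i‖))) := by
    intro h ω hω
    by_cases hφ : ∀ i, φ ‖ω i - x‖ < ‖x - x₀‖
    · exact h ω hω hφ
    · push Not at hφ
      obtain ⟨i, hi⟩ := hφ
      refine (Metric.infEDist_le_edist_of_mem hx₀).trans ?_
      rw [edist_dist, dist_eq_norm]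
      refine ENNReal.ofReal_le_ofReal (hi.trans (mono (norm_nonneg _) ?_))
      rw [norm_sub_rev]
      exact le_ciSup (Set.finite_range fun i => ‖x - ω i‖).bddAbove i
  exact ⟨⟨all_of_infDist, infDist_of_all⟩, ⟨fun h ω hω _ => h ω hω, fun h => all_of_near_point (near_point_of_near_base h)⟩,
    ⟨near_point_of_near_base, fun h ω hω _ => all_of_near_point h ω hω⟩⟩
end

section
/- Let X be a Banach space, Ω₁,…,Ωₙ closed subsets of X, x̄ ∈ ⋂ᵢ₌₁ⁿ Ωᵢ, let φ : [0,∞) → [0,∞) be continuous, strictly increasing, with φ(0) = 0 and φ(t) → ∞ as t → ∞, and let δ > 0. Suppose there exists γ > 0 such that for any x₁,…,xₙ ∈ X satisfying 0 < max₁≤i≤n ‖xᵢ‖ < φ⁻¹(δ), there exists λ ∈ (φ(max₁≤i≤n ‖xᵢ‖), δ) such that sup over u₁ ∈ Ω₁,…,uₙ ∈ Ωₙ, u ∈ X with (u₁,…,uₙ,u) ≠ (ω₁,…,ωₙ,x) of the quotient [φ(max₁≤i≤n ‖ωᵢ − xᵢ − x‖) − φ(max₁≤i≤n ‖uᵢ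 − xᵢ − u‖)] / ‖(u₁−ω₁,…,uₙ−ωₙ,u−x)‖_γ is ≥ 1, for all x ∈ X and ωᵢ ∈ Ωᵢ (i = 1,…,n) satisfying ‖x − x̄‖ < λ, max₁≤i≤n ‖ωᵢ − x̄‖ < λ/γ, and 0 < max₁≤i≤n ‖ωᵢ − xᵢ − x‖ ≤ max₁≤i≤n ‖xᵢ‖. Then {Ω₁,…,Ωₙ} is φ-semitransversal at x̄ with δ. -/
open Set Filter
open scoped ENNReal

variable {X : Type*} [NormedAddCommGroup X] [NormedSpace ℝ X]

/-- **Ekeland's variational principle** on a complete metric space. -/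
theorem LowerSemicontinuous.exists_ekeland {α : Type*} [MetricSpace α] [CompleteSpace α]
    {f : α → ℝ} (hf : LowerSemicontinuous f) (hbdd : BddBelow (Set.range f))
    {c : ℝ} (hc : 0 < c) (p₀ : α) :
    ∃ p, f p + c * dist p p₀ ≤ f p₀ ∧ ∀ q, q ≠ p → f p < f q + c * dist q p := by
  let T : α → Set α := fun p => {q | f q + c * dist q p ≤ f p}
  have hself : ∀ p, p ∈ T p := fun p => by simp [T]
  have htrans : ∀ {p q r}, q ∈ T p → r ∈ T q → r ∈ T p := by
    intro p q r hq hr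
    simp only [T, mem_ofPred_eq] at *
    nlinarith [mul_le_mul_of_nonneg_left (dist_triangle r q p) hc.le]
  have hclosed : ∀ p, IsClosed (T p) := fun p =>
    (hf.add (continuous_const.mul
      (continuous_id.dist continuous_const)).lowerSemicontinuous).isClosed_preimage (f p)
  have hstep : ∀ (k : ℕ) (p : α), ∃ p' ∈ T p, ∀ q ∈ T p, f p' ≤ f q + (1 / 2) ^ k := by
    intro k p
    have hb : BddBelow (f '' T p) := hbdd.mono (image_subset_range f _)
    obtain ⟨_, ⟨p', hp', rfl⟩, hlt⟩ := exists_lt_of_csInf_lt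
      ((show (T p).Nonempty from ⟨p, hself p⟩).image f)
      (lt_add_of_pos_right (sInf (f '' T p)) (by positivity : (0 : ℝ) < (1 / 2) ^ k))
    exact ⟨p', hp', fun q hq => by linarith [csInf_le hb (mem_image_of_mem f hq)]⟩
  choose step hstepT hstep using hstep
  let s : ℕ → α := fun k => Nat.rec p₀ step k
  have hsucc : ∀ k, s (k + 1) = step k (s k) := fun _ => rfl
  have hdist : ∀ k, ∀ q ∈ T (s (k + 1)), dist q (s (k + 1)) ≤ 1 / c * (1 / 2) ^ k := by
    intro k q hq
    have h := hstep k (s k) q (htrans (hstepT k (s k)) hq)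
    rw [← hsucc] at h
    simp only [T, mem_ofPred_eq] at hq
    rw [one_div_mul_eq_div, le_div_iff₀ hc]
    linarith
  have hmem : ∀ k j, s (k + j) ∈ T (s k) := by
    intro k j
    induction j with
    | zero => exact hself _
    | succ j ih => exact htrans ih (hstepT (k + j) (s (k + j)))
  have hcauchy : CauchySeq fun k => s (k + 1) :=
    cauchySeq_of_le_geometric (1 / 2) (1 / c) (by norm_num) fun k => by
      rw [dist_comm]
      exact hdist k _ (hmem (k + 1) 1)
  obtain ⟨p, hp⟩ := cauchySeq_tendsto_of_complete hcauchy
  have hlim : Tendsto s atTop (nhds p) := (tendsto_add_atTop_iff_nat 1).1 hp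
  have hpT : ∀ k, p ∈ T (s k) := fun k =>
    (hclosed (s k)).mem_of_tendsto hlim <| (eventually_ge_atTop k).mono fun j hj => by
      obtain ⟨i, rfl⟩ := Nat.exists_eq_add_of_le hj
      exact hmem k i
  refine ⟨p, hpT 0, fun q hq => ?_⟩
  by_contra! hle
  have hqT : ∀ k, q ∈ T (s k) := fun k => htrans (hpT k) hle
  have h0 : Tendsto (fun k : ℕ => 1 / c * (1 / 2 : ℝ) ^ k) atTop (nhds 0) := by
    simpa using (tendsto_pow_atTop_nhds_zero_of_lt_one (by norm_num : (0 : ℝ) ≤ 1 / 2)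
      (by norm_num)).const_mul (1 / c)
  have := le_of_tendsto_of_tendsto' (tendsto_const_nhds.dist hp) h0 fun k => hdist k q (hqT (k + 1))
  exact hq (dist_le_zero.1 this)

theorem Pi.norm_eq_iSup_norm {ι E : Type*} [Fintype ι] [SeminormedAddCommGroup E] (x : ι → E) :
    ‖x‖ = ⨆ i, ‖x i‖ :=
  le_antisymm
    ((pi_norm_le_iff_of_nonneg (Real.iSup_nonneg fun _ => norm_nonneg _)).2
      (le_ciSup (finite_range fun i => ‖x i‖).bddAbove))
    (Real.iSup_le (norm_le_pi_norm x) (norm_nonneg x))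

/-- Theorem 4.1 (nonlocal slope sufficient condition for semitransversality). The
supremum condition "sup ≥ 1" is rendered as: for every `c < 1` there is an admissible
point with quotient `> c`. -/
theorem semitransversal_of_slope_condition {Y : Type*} [NormedAddCommGroup Y]
    [NormedSpace ℝ Y] [CompleteSpace Y] {n : ℕ} (Ω : Fin n → Set Y)
    (hΩ : ∀ i, IsClosed (Ω i)) (x₀ : Y) (hx₀ : x₀ ∈ ⋂ i, Ω i)
    (φ φinv : ℝ → ℝ) (hmono : StrictMonoOn φ (Set.Ici 0)) (hcont : ContinuousOn φ (Set.Ici 0))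
    (hzero : φ 0 = 0) (hlim : Tendsto φ atTop atTop)
    (hinv₁ : ∀ t : ℝ, 0 ≤ t → φinv (φ t) = t) (hinv₂ : ∀ t : ℝ, 0 ≤ t → φ (φinv t) = t)
    (hinvnn : ∀ t : ℝ, 0 ≤ t → 0 ≤ φinv t)
    (δ : ℝ) (hδ : 0 < δ) (γ : ℝ) (hγ : 0 < γ)
    (H : ∀ xs : Fin n → Y, 0 < ⨆ i, ‖xs i‖ → (⨆ i, ‖xs i‖) < φinv δ →
      ∃ lam : ℝ, φ (⨆ i, ‖xs i‖) < lam ∧ lam < δ ∧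
        ∀ (x : Y) (ω : Fin n → Y), (∀ i, ω i ∈ Ω i) →
          ‖x - x₀‖ < lam → (⨆ i, ‖ω i - x₀‖) < lam / γ →
          0 < ⨆ i, ‖ω i - xs i - x‖ → (⨆ i, ‖ω i - xs i - x‖) ≤ ⨆ i, ‖xs i‖ →
          ∀ c : ℝ, c < 1 →
            ∃ (u : Fin n → Y) (u' : Y), (∀ i, u i ∈ Ω i) ∧ (u, u') ≠ (ω, x) ∧
              c < (φ (⨆ i, ‖ω i - xs i - x‖) - φ (⨆ i, ‖u i - xs i - u'‖)) /
                    max ‖u' - x‖ (γ * ⨆ i, ‖u i - ω i‖)) :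
    SemitransversalWith Ω x₀ φ δ := by
  intro ρ hρ hρδ xs hxs
  have hφ : ∀ t, 0 ≤ t → 0 ≤ φ t := fun t ht =>
    hzero ▸ hmono.monotoneOn self_mem_Ici ht ht
  have hsup : ∀ g : Fin n → Y, (⨆ i, ‖g i‖) = ‖g‖ := fun g => (Pi.norm_eq_iSup_norm g).symm
  simp only [hsup] at H hxs
  rw [mem_iInter] at hx₀
  rcases (norm_nonneg xs).eq_or_lt with h0 | hpos
  · have hxs0 : xs = 0 := norm_eq_zero.1 h0.symm
    exact ⟨x₀, mem_iInter.2 fun i => ⟨x₀, hx₀ i, by simp [hxs0]⟩, Metric.mem_ball_self hρ⟩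
  have hlt : ‖xs‖ < φinv δ := by
    rw [← hmono.lt_iff_lt (norm_nonneg xs) (hinvnn δ hδ.le), hinv₂ δ hδ.le]
    exact hxs.trans hρδ
  obtain ⟨lam, hlam, -, H⟩ := H xs hpos hlt
  obtain ⟨r, hr, hrlt⟩ := exists_between (lt_min hxs hlam)
  obtain ⟨hrρ, hrlam⟩ := lt_min_iff.1 hrlt
  have hφpos : 0 < φ ‖xs‖ := hzero ▸ hmono self_mem_Ici hpos.le hpos
  have hr0 : 0 < r := hφpos.trans hr
  by_contra hempty
  -- Rescaling the first component by `γ` turns the `γ`-norm into the product norm.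
  let S : Set ((Fin n → Y) × Y) := {p | ∀ i, γ⁻¹ • p.1 i ∈ Ω i}
  have hS : IsClosed S := by
    simp only [S, ofPred_forall]
    exact isClosed_iInter fun i => (hΩ i).preimage (by fun_prop)
  have : CompleteSpace S := hS.completeSpace_coe
  let f : S → ℝ := fun p => φ ‖fun i => γ⁻¹ • p.1.1 i - xs i - p.1.2‖
  have hf : Continuous f := hcont.comp_continuous (by fun_prop) fun p => norm_nonneg _
  have hbdd : BddBelow (Set.range f) :=
    ⟨0, by rintro _ ⟨p, rfl⟩; exact hφ _ (norm_nonneg _)⟩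
  let toS : ∀ (u : Fin n → Y) (x : Y), (∀ i, u i ∈ Ω i) → S := fun u x hu =>
    ⟨(γ • u, x), fun i => by simpa [smul_smul, hγ.ne'] using hu i⟩
  have hftoS : ∀ u x hu, f (toS u x hu) = φ ‖fun i => u i - xs i - x‖ := fun u x hu => by
    simp [f, toS, smul_smul, hγ.ne']
  obtain ⟨⟨⟨v, x⟩, hv⟩, hp, hmin⟩ := hf.lowerSemicontinuous.exists_ekeland hbdd
    (div_pos hφpos hr0) (toS (fun _ => x₀) x₀ hx₀)
  obtain ⟨ω, rfl⟩ : ∃ ω, v = γ • ω := ⟨γ⁻¹ • v, by simp [smul_smul, hγ.ne']⟩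
  have hω : ∀ i, ω i ∈ Ω i := fun i => by simpa [smul_smul, hγ.ne'] using hv i
  have hdist : ∀ u x' hu, dist (toS u x' hu) (toS ω x hω) = max ‖x' - x‖ (γ * ‖u - ω‖) := by
    intro u x' hu
    rw [Subtype.dist_eq, Prod.dist_eq, dist_smul₀, Real.norm_of_nonneg hγ.le, dist_eq_norm,
      dist_eq_norm, max_comm]
  change f (toS ω x hω) + _ * dist (toS ω x hω) _ ≤ _ at hp
  change ∀ q, q ≠ toS ω x hω → f (toS ω x hω) < f q + _ * dist q (toS ω x hω) at hmin
  have hstart : f (toS (fun _ => x₀) x₀ hx₀) = φ ‖xs‖ := by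
    rw [hftoS _ _ hx₀]
    congr 1
    rw [← norm_neg xs]
    congr 1
    ext i
    simp
  rw [dist_comm, hdist _ _ hx₀, hstart, hftoS ω x hω] at hp
  set F := ‖fun i => ω i - xs i - x‖
  set d := max ‖x₀ - x‖ (γ * ‖(fun _ => x₀) - ω‖)
  have hd0 : 0 ≤ d := le_max_of_le_left (norm_nonneg _)
  have hdr : d ≤ r := by
    have h := (le_add_of_nonneg_left (hφ F (norm_nonneg _))).trans hp
    rw [div_mul_eq_mul_div, div_le_iff₀ hr0] at h
    exact le_of_mul_le_mul_left h hφpos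
  have hx : ‖x - x₀‖ ≤ r := norm_sub_rev x x₀ ▸ (le_max_left _ _).trans hdr
  have hFle : F ≤ ‖xs‖ := by
    rw [← hmono.le_iff_le (norm_nonneg _) (norm_nonneg _)]
    exact (le_add_of_nonneg_right (by positivity)).trans hp
  have hFpos : 0 < F := by
    refine (norm_nonneg _).lt_of_ne fun h => hempty ⟨x, mem_iInter.2 fun i => ⟨ω i, hω i, ?_⟩, ?_⟩
    · exact sub_eq_zero.1 (congrFun (norm_eq_zero.1 h.symm) i)
    · rw [mem_ball_iff_norm]
      exact hx.trans_lt hrρ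
  have hωlt : ‖fun i => ω i - x₀‖ < lam / γ := by
    rw [lt_div_iff₀ hγ, mul_comm]
    refine lt_of_le_of_lt ?_ hrlam
    have h : ‖fun i => ω i - x₀‖ = ‖(fun _ => x₀) - ω‖ := norm_sub_rev ω fun _ => x₀
    exact h ▸ (le_max_right _ _).trans hdr
  obtain ⟨u, u', hu, hne, hquot⟩ := H x ω hω (hx.trans_lt hrlam) hωlt hFpos hFle
    (φ ‖xs‖ / r) ((div_lt_one hr0).2 hr)
  have hneS : toS u u' hu ≠ toS ω x hω := fun h => hne <| by
    have h' := congrArg Subtype.val h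
    simp only [toS, Prod.mk.injEq] at h'
    rw [smul_right_injective _ hγ.ne' h'.1, h'.2]
  have hlt := hmin _ hneS
  have hDpos := dist_pos.2 hneS
  rw [hdist u u' hu] at hlt hDpos
  rw [hftoS ω x hω, hftoS u u' hu] at hlt
  change _ < _ / max ‖u' - x‖ (γ * ‖u - ω‖) at hquot
  rw [lt_div_iff₀ hDpos] at hquot
  linarith
end

section
/- Let X be a Banach space, Ω₁,…,Ωₙ closed subsets of X, x̄ ∈ ⋂ᵢ₌₁ⁿ Ωᵢ, let φ : [0,∞) → [0,∞) be continuous, strictly increasing, with φ(0) = 0 and φ(t) → ∞ as t → ∞, and let δ₁ > 0, δ₂ > 0. Suppose there exists γ > 0 such that for any ω'ᵢ ∈ Ωᵢ ∩ B_{δ₂}(x̄) (i = 1,…,n) and any ξ ∈ (0, φ⁻¹(δ₁)), there exists λ ∈ (φ(ξ), δ₁) such that sup over u₁ ∈ Ω₁,…,uₙ ∈ Ωₙ, u ∈ X with (u₁,…,uₙ,u) ≠ (ω₁,…,ωₙ,x) of the quotient [φ(max₁≤i≤n ‖ωᵢ − xᵢ − x‖) − φ(max₁≤i≤n ‖uᵢ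 − xᵢ − u‖)] / ‖(u₁−ω₁,…,uₙ−ωₙ,u−x)‖_γ is ≥ 1, for all x, x₁,…,xₙ ∈ X and ωᵢ ∈ Ωᵢ (i = 1,…,n) satisfying ‖x − x̄‖ < λ, max₁≤i≤n ‖ωᵢ − ω'ᵢ‖ < λ/γ, and 0 < max₁≤i≤n ‖ωᵢ − xᵢ − x‖ ≤ max₁≤i≤n ‖ω'ᵢ − xᵢ − x̄‖ = ξ. Then {Ω₁,…,Ωₙ} is φ-transversal at x̄ with δ₁ and δ₂. -/
open Set Filter
open scoped ENNReal

variable {X : Type*} [NormedAddCommGroup X] [NormedSpace ℝ X]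

open scoped Topology

/-- **Ekeland's variational principle** for a lower semicontinuous real function that is bounded
below on a complete metric space. -/
theorem exists_ekeland_point {α : Type*} [MetricSpace α] [CompleteSpace α] {f : α → ℝ}
    (hf : LowerSemicontinuous f) (hb : BddBelow (range f)) {c : ℝ} (hc : 0 < c) (x₀ : α) :
    ∃ z, f z + c * dist x₀ z ≤ f x₀ ∧ ∀ y, y ≠ z → f z < f y + c * dist z y := by
  have trans : ∀ {x y z : α}, f y + c * dist x y ≤ f x → f z + c * dist y z ≤ f y →
      f z + c * dist x z ≤ f x := by
    intro x y z hxy hyz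
    have := mul_le_mul_of_nonneg_left (dist_triangle x y z) hc.le
    linarith
  have step : ∀ x, ∃ y, f y + c * dist x y ≤ f x ∧
      ∀ w, f w + c * dist x w ≤ f x → 2 * f y - f x ≤ f w := by
    intro x
    set T := f '' {y | f y + c * dist x y ≤ f x} with hT
    have hxT : f x ∈ T := ⟨x, by simp, rfl⟩
    have hTb : BddBelow T := hb.mono (image_subset_range _ _)
    rcases (csInf_le hTb hxT).eq_or_lt with h | h
    · refine ⟨x, by simp, fun w hw => ?_⟩
      have := csInf_le hTb (mem_image_of_mem f hw)
      linarith
    · obtain ⟨_, ⟨y, hy, rfl⟩, hlt⟩ :=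
        exists_lt_of_csInf_lt ⟨_, hxT⟩ (show sInf T < (f x + sInf T) / 2 by linarith)
      refine ⟨y, hy, fun w hw => ?_⟩
      have := csInf_le hTb (mem_image_of_mem f hw)
      linarith
  choose g hg hg' using step
  let s : ℕ → α := fun k => g^[k] x₀
  have hs : ∀ k, s (k + 1) = g (s k) := fun k => Function.iterate_succ_apply' g k x₀
  have hle : ∀ m k, m ≤ k → f (s k) + c * dist (s m) (s k) ≤ f (s m) := by
    intro m k hmk
    induction k, hmk using Nat.le_induction with
    | base => simp
    | succ k _ ih => exact trans ih (by rw [hs]; exact hg _)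
  have hanti : Antitone fun k => f (s k) := by
    intro m k hmk
    have := hle m k hmk
    have := mul_nonneg hc.le (dist_nonneg (x := s m) (y := s k))
    show f (s k) ≤ f (s m)
    linarith
  have hsb : BddBelow (range fun k => f (s k)) :=
    hb.mono (range_subset_iff.2 fun k => mem_range_self _)
  set L := ⨅ k, f (s k)
  have hL : Tendsto (fun k => f (s k)) atTop (𝓝 L) := tendsto_atTop_ciInf hanti hsb
  have hcauchy : CauchySeq s := by
    refine cauchySeq_of_le_tendsto_0' (fun k => (f (s k) - L) / c) (fun m k hmk => ?_) ?_
    · rw [le_div_iff₀ hc]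
      have := hle m k hmk
      have : L ≤ f (s k) := ciInf_le hsb k
      linarith
    · simpa using (hL.sub_const L).div_const c
  obtain ⟨z, hz⟩ := cauchySeq_tendsto_of_complete hcauchy
  have hzs : ∀ m, f z + c * dist (s m) z ≤ f (s m) := by
    intro m
    have hlsc : LowerSemicontinuous fun y => f y + c * dist (s m) y :=
      hf.add (by fun_prop : Continuous fun y => c * dist (s m) y).lowerSemicontinuous
    exact (hlsc.isClosed_preimage (f (s m))).mem_of_tendsto hz
      ((eventually_ge_atTop m).mono fun k hk => hle m k hk)
  refine ⟨z, hzs 0, fun y hy => ?_⟩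
  by_contra! hyz
  have hLy : L ≤ f y := by
    have hlim : Tendsto (fun k => 2 * f (s (k + 1)) - f (s k)) atTop (𝓝 (2 * L - L)) :=
      ((hL.comp (tendsto_add_atTop_nat 1)).const_mul 2).sub hL
    have := le_of_tendsto' hlim fun k => by
      rw [hs]; exact hg' _ _ (trans (hzs k) hyz)
    linarith
  have hzL : f z ≤ L := ge_of_tendsto' hL fun k => by
    have := hzs k
    have := mul_nonneg hc.le (dist_nonneg (x := s k) (y := z))
    linarith
  have := mul_pos hc (dist_pos.2 hy.symm)
  linarith

/-- The sup norm on a finite product is the conditionally complete supremum of the norms. -/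
theorem ciSup_norm_eq_pi_norm {ι E : Type*} [Fintype ι] [SeminormedAddCommGroup E] (x : ι → E) :
    ⨆ i, ‖x i‖ = ‖x‖ := by
  apply le_antisymm
  · exact Real.iSup_le (fun i => norm_le_pi_norm x i) (norm_nonneg x)
  · exact (pi_norm_le_iff_of_nonneg (Real.iSup_nonneg fun i => norm_nonneg _)).2 fun i =>
      le_ciSup (f := fun i => ‖x i‖) (finite_range _).bddAbove i

/-- Ekeland's variational principle on `(∏ᵢ Ωᵢ) × Y` for the norm
`max {‖x‖, γ · maxᵢ ‖uᵢ‖}`. -/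
theorem exists_ekeland_point_pi_prod {Y ι : Type*} [NormedAddCommGroup Y] [NormedSpace ℝ Y]
    [CompleteSpace Y] [Fintype ι] {Ω : ι → Set Y} (hΩ : ∀ i, IsClosed (Ω i)) {γ : ℝ} (hγ : 0 < γ)
    {f : (ι → Y) → Y → ℝ} (hf : Continuous fun p : (ι → Y) × Y => f p.1 p.2)
    (hb : ∀ u x, 0 ≤ f u x) {c : ℝ} (hc : 0 < c) {ω₀ : ι → Y} (hω₀ : ∀ i, ω₀ i ∈ Ω i) (x₀ : Y) :
    ∃ (ω : ι → Y) (x : Y), (∀ i, ω i ∈ Ω i) ∧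
      f ω x + c * max ‖x - x₀‖ (γ * ‖ω - ω₀‖) ≤ f ω₀ x₀ ∧
      ∀ (u : ι → Y) (u' : Y), (∀ i, u i ∈ Ω i) → (u, u') ≠ (ω, x) →
        f ω x < f u u' + c * max ‖u' - x‖ (γ * ‖u - ω‖) := by
  let S : Set (Y × (ι → Y)) := {p | ∀ i, (γ⁻¹ • p.2) i ∈ Ω i}
  have hS : IsClosed S := by
    simp only [S, ofPred_forall]
    exact isClosed_iInter fun i => (hΩ i).preimage
      (by fun_prop : Continuous fun p : Y × (ι → Y) => (γ⁻¹ • p.2) i)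
  have : CompleteSpace S := hS.completeSpace_coe
  let mk : ∀ (u : ι → Y) (x : Y), (∀ i, u i ∈ Ω i) → S := fun u x hu =>
    ⟨(x, γ • u), fun i => by simpa [smul_smul, hγ.ne'] using hu i⟩
  let F : S → ℝ := fun p => f (γ⁻¹ • p.1.2) p.1.1
  have hF : Continuous F :=
    hf.comp (by fun_prop : Continuous fun p : S => (γ⁻¹ • p.1.2, p.1.1))
  have hFmk : ∀ u x hu, F (mk u x hu) = f u x := by
    intro u x hu
    simp [F, mk, smul_smul, hγ.ne']
  have hdist : ∀ u x hu v y hv,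
      dist (mk u x hu) (mk v y hv) = max ‖y - x‖ (γ * ‖v - u‖) := by
    intro u x hu v y hv
    rw [dist_comm, Subtype.dist_eq, Prod.dist_eq]
    simp only [mk, dist_eq_norm, ← smul_sub, norm_smul, Real.norm_of_nonneg hγ.le]
  obtain ⟨⟨⟨x, w⟩, hw⟩, hz, hmin⟩ := exists_ekeland_point hF.lowerSemicontinuous
    ⟨0, by rintro _ ⟨p, rfl⟩; exact hb _ _⟩ hc (mk ω₀ x₀ hω₀)
  have hzeq : (⟨(x, w), hw⟩ : S) = mk (γ⁻¹ • w) x hw := by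
    simp [mk, smul_smul, hγ.ne']
  rw [hzeq] at hz hmin
  refine ⟨γ⁻¹ • w, x, hw, by rwa [hFmk _ _ hw, hFmk _ _ hω₀, hdist _ _ hω₀ _ _ hw] at hz, fun u u' hu hne => ?_⟩
  have hlt := hmin (mk u u' hu) fun h => hne ?_
  · rwa [hFmk _ _ hw, hFmk _ _ hu, hdist _ _ hw _ _ hu] at hlt
  · have h1 := congrArg (fun p : S => p.1) h
    simp only [mk, Prod.mk.injEq] at h1
    exact Prod.ext (smul_right_injective _ hγ.ne' h1.2) h1.1

/-- Theorem 4.3 (nonlocal slope sufficient condition for transversality). The supremum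
condition "sup ≥ 1" is rendered as: for every `c < 1` there is an admissible point with
quotient `> c`. -/
theorem transversal_of_slope_condition {Y : Type*} [NormedAddCommGroup Y]
    [NormedSpace ℝ Y] [CompleteSpace Y] {n : ℕ} (Ω : Fin n → Set Y)
    (hΩ : ∀ i, IsClosed (Ω i)) (x₀ : Y) (hx₀ : x₀ ∈ ⋂ i, Ω i)
    (φ φinv : ℝ → ℝ) (hmono : StrictMonoOn φ (Set.Ici 0)) (hcont : ContinuousOn φ (Set.Ici 0))
    (hzero : φ 0 = 0) (hlim : Tendsto φ atTop atTop)
    (hinv₁ : ∀ t : ℝ, 0 ≤ t → φinv (φ t) = t) (hinv₂ : ∀ t : ℝ, 0 ≤ t → φ (φinv t) = t)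
    (hinvnn : ∀ t : ℝ, 0 ≤ t → 0 ≤ φinv t)
    (δ₁ δ₂ : ℝ) (hδ₁ : 0 < δ₁) (hδ₂ : 0 < δ₂) (γ : ℝ) (hγ : 0 < γ)
    (H : ∀ ω' : Fin n → Y, (∀ i, ω' i ∈ Ω i ∩ Metric.ball x₀ δ₂) →
      ∀ ξ : ℝ, 0 < ξ → ξ < φinv δ₁ →
      ∃ lam : ℝ, φ ξ < lam ∧ lam < δ₁ ∧
        ∀ (x : Y) (xs ω : Fin n → Y), (∀ i, ω i ∈ Ω i) →
          ‖x - x₀‖ < lam → (⨆ i, ‖ω i - ω' i‖) < lam / γ →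
          0 < ⨆ i, ‖ω i - xs i - x‖ → (⨆ i, ‖ω i - xs i - x‖) ≤ ⨆ i, ‖ω' i - xs i - x₀‖ →
          (⨆ i, ‖ω' i - xs i - x₀‖) = ξ →
          ∀ c : ℝ, c < 1 →
            ∃ (u : Fin n → Y) (u' : Y), (∀ i, u i ∈ Ω i) ∧ (u, u') ≠ (ω, x) ∧
              c < (φ (⨆ i, ‖ω i - xs i - x‖) - φ (⨆ i, ‖u i - xs i - u'‖)) /
                    max ‖u' - x‖ (γ * ⨆ i, ‖u i - ω i‖)) :
    TransversalWith Ω x₀ φ δ₁ δ₂ := by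
  intro ρ _ hρδ ω' a hω' hφρ
  simp only [ciSup_norm_eq_pi_norm] at hφρ
  have hφnn : ∀ t, 0 ≤ t → 0 ≤ φ t := fun t ht => by
    simpa [hzero] using hmono.monotoneOn self_mem_Ici ht ht
  suffices h : ∃ (ω : Fin n → Y) (v : Y), (∀ i, ω i ∈ Ω i) ∧ ‖v‖ < ρ ∧
      ∀ i, ω i - ω' i - a i = v by
    obtain ⟨ω, v, hω, hv, heq⟩ := h
    exact ⟨v, mem_iInter.2 fun i => ⟨ω i, hω i, heq i⟩, by simpa using hv⟩
  rcases (norm_nonneg a).eq_or_lt with hξ | hξ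
  · have ha : a = 0 := norm_eq_zero.1 hξ.symm
    exact ⟨ω', 0, fun i => (hω' i).1, by simpa, by simp [ha]⟩
  have hφξ : 0 < φ ‖a‖ := by simpa [hzero] using hmono self_mem_Ici hξ.le hξ
  have hξδ : ‖a‖ < φinv δ₁ := by
    rw [← hmono.lt_iff_lt hξ.le (hinvnn δ₁ hδ₁.le), hinv₂ δ₁ hδ₁.le]
    linarith
  obtain ⟨lam, hlam, -, hslope⟩ := H ω' hω' ‖a‖ hξ hξδ
  obtain ⟨r, hr, hr'⟩ := exists_between (lt_min hlam hφρ)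
  obtain ⟨hrlam, hrρ⟩ := lt_min_iff.1 hr'
  have hr0 : 0 < r := hφξ.trans hr
  let b : Fin n → Y := fun i => ω' i + a i - x₀
  let f : (Fin n → Y) → Y → ℝ := fun u x => φ ‖fun i => u i - b i - x‖
  have hf : Continuous fun p : (Fin n → Y) × Y => f p.1 p.2 :=
    hcont.comp_continuous (by fun_prop) fun p => norm_nonneg _
  have hstart : ‖fun i => ω' i - b i - x₀‖ = ‖a‖ := by
    rw [← norm_neg a]
    congr 1
    ext i
    simp only [b, Pi.neg_apply]
    abel
  obtain ⟨ω, x, hω, hle, hmin⟩ := exists_ekeland_point_pi_prod hΩ hγ hf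
    (fun u x => hφnn _ (norm_nonneg _)) (div_pos hφξ hr0) (fun i => (hω' i).1) x₀
  have hf₀ : f ω' x₀ = φ ‖a‖ := congrArg φ hstart
  rw [hf₀] at hle
  have hd : max ‖x - x₀‖ (γ * ‖ω - ω'‖) ≤ r := by
    have h1 : φ ‖a‖ / r * max ‖x - x₀‖ (γ * ‖ω - ω'‖) ≤ φ ‖a‖ / r * r := by
      rw [div_mul_cancel₀ _ hr0.ne']
      have : 0 ≤ f ω x := hφnn _ (norm_nonneg _)
      linarith
    exact le_of_mul_le_mul_left h1 (div_pos hφξ hr0)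
  obtain ⟨hx, hωd⟩ := max_le_iff.1 hd
  have hfle : ‖fun i => ω i - b i - x‖ ≤ ‖a‖ := by
    rw [← hmono.le_iff_le (norm_nonneg _) hξ.le]
    have : 0 ≤ φ ‖a‖ / r * max ‖x - x₀‖ (γ * ‖ω - ω'‖) := by positivity
    change f ω x ≤ _
    linarith
  have hzero_norm : ‖fun i => ω i - b i - x‖ = 0 := by
    by_contra hne
    obtain ⟨u, u', hu, hune, hlt⟩ := hslope x b ω hω (hx.trans_lt hrlam)
      (by
        rw [ciSup_norm_eq_pi_norm fun i => ω i - ω' i, lt_div_iff₀ hγ, mul_comm]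
        exact hωd.trans_lt hrlam)
      (by
        rw [ciSup_norm_eq_pi_norm fun i => ω i - b i - x]
        exact lt_of_le_of_ne (norm_nonneg _) (Ne.symm hne))
      (by
        rw [ciSup_norm_eq_pi_norm fun i => ω i - b i - x,
          ciSup_norm_eq_pi_norm fun i => ω' i - b i - x₀, hstart]
        exact hfle)
      (by rw [ciSup_norm_eq_pi_norm fun i => ω' i - b i - x₀, hstart])
      (φ ‖a‖ / r) ((div_lt_one hr0).2 hr)
    rw [ciSup_norm_eq_pi_norm fun i => ω i - b i - x,
      ciSup_norm_eq_pi_norm fun i => u i - b i - u',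
      ciSup_norm_eq_pi_norm fun i => u i - ω i] at hlt
    have hpos : 0 < max ‖u' - x‖ (γ * ‖u - ω‖) := by
      by_contra! hnonpos
      obtain ⟨h1, h2⟩ := max_le_iff.1 hnonpos
      have h3 : ‖u - ω‖ ≤ 0 := nonpos_of_mul_nonpos_right h2 hγ
      exact hune (Prod.ext (sub_eq_zero.1 (norm_le_zero_iff.1 h3))
        (sub_eq_zero.1 (norm_le_zero_iff.1 h1)))
    have h1 : φ ‖a‖ / r * max ‖u' - x‖ (γ * ‖u - ω‖) < f ω x - f u u' := (lt_div_iff₀ hpos).1 hlt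
    have h2 := hmin u u' hu hune
    linarith
  refine ⟨ω, x - x₀, hω, hx.trans_lt hrρ, fun i => ?_⟩
  have hi := congrFun (norm_eq_zero.1 hzero_norm) i
  simp only [b, Pi.zero_apply] at hi
  rw [← sub_eq_zero, ← hi]
  abel
end

section
/- Let X be a normed vector space, Ω₁,…,Ωₙ ⊆ X, x̄ ∈ ⋂ᵢ₌₁ⁿ Ωᵢ, let φ : [0,∞) → [0,∞) be continuous, strictly increasing, with φ(0) = 0 and φ(t) → ∞ as t → ∞, and let F : X ⇒ Xⁿ be defined by F(x) := (Ω₁ − x) × ⋯ × (Ωₙ − x), where Xⁿ carries the maximum norm, so that (0,…,0) ∈ F(x̄). Then: (i) {Ω₁,…,Ωₙ} is φ-semitransversal at x̄ with some δ > 0 if and only if F is φ-semiregular at (x̄,(0,…,0)) with δ; (ii) {Ω₁,…,Ωₙ} is φ-subtransversal at x̄ with some δ₁ > 0 and δ₂ > 0 if and only if F is φ-subregular at (x̄,(0,…,0)) with δ₁ and δ₂; (iii) if {Ω₁,…,Ωₙ} is φ-transversal at x̄ with some δ₁ > 0 and δ₂ > 0, then F is φ-regular at (x̄,(0,…,0))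 with any δ₁' ∈ (0,δ₁] and δ₂' > 0 satisfying φ⁻¹(δ₁') + δ₂' ≤ δ₂; conversely, if F is φ-regular at (x̄,(0,…,0)) with some δ₁ > 0 and δ₂ > 0, then {Ω₁,…,Ωₙ} is φ-transversal at x̄ with any δ₁' ∈ (0,δ₁] and δ₂' > 0 satisfying φ⁻¹(δ₁') + δ₂' ≤ δ₂. -/
open Set Filter
open scoped ENNReal

variable {X : Type*} [NormedAddCommGroup X] [NormedSpace ℝ X]

/-- `F` is `φ`-semiregular at `(x₀,y₀)` with `δ > 0`: `d(x₀, F⁻¹(y)) ≤ φ(d(y,y₀))` for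
all `y` with `φ(d(y,y₀)) < δ` (the distance to a possibly empty set being `+∞`). -/
def SemiregularWith {Z W : Type*} [PseudoMetricSpace Z] [PseudoMetricSpace W]
    (F : W → Set Z) (x₀ : W) (y₀ : Z) (φ : ℝ → ℝ) (δ : ℝ) : Prop :=
  ∀ y : Z, φ (dist y y₀) < δ →
    EMetric.infEdist x₀ {x | y ∈ F x} ≤ ENNReal.ofReal (φ (dist y y₀))

/-- `F` is `φ`-subregular at `(x₀,y₀)` with `δ₁, δ₂ > 0`: `d(x, F⁻¹(y₀)) ≤ φ(d(y₀,F(x)))`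
for all `x ∈ B_{δ₂}(x₀)` with `φ(d(y₀,F(x))) < δ₁` (with the convention
`d(y₀,∅) = +∞`, i.e. only nonempty values of `F` are constrained). -/
def SubregularWith {Z W : Type*} [PseudoMetricSpace Z] [PseudoMetricSpace W]
    (F : W → Set Z) (x₀ : W) (y₀ : Z) (φ : ℝ → ℝ) (δ₁ δ₂ : ℝ) : Prop :=
  ∀ x ∈ Metric.ball x₀ δ₂, (F x).Nonempty → φ (Metric.infDist y₀ (F x)) < δ₁ →
    EMetric.infEdist x {x' | y₀ ∈ F x'} ≤ ENNReal.ofReal (φ (Metric.infDist y₀ (F x)))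

/-- `F` is `φ`-regular at `(x₀,y₀)` with `δ₁, δ₂ > 0`: `d(x, F⁻¹(y)) ≤ φ(d(y,F(x)))`
for all `x, y` with `d(x,x₀) + d(y,y₀) < δ₂` and `φ(d(y,F(x))) < δ₁`. -/
def RegularWith {Z W : Type*} [PseudoMetricSpace Z] [PseudoMetricSpace W]
    (F : W → Set Z) (x₀ : W) (y₀ : Z) (φ : ℝ → ℝ) (δ₁ δ₂ : ℝ) : Prop :=
  ∀ (x : W) (y : Z), dist x x₀ + dist y y₀ < δ₂ → (F x).Nonempty →
    φ (Metric.infDist y (F x)) < δ₁ →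
    EMetric.infEdist x {x' | y ∈ F x'} ≤ ENNReal.ofReal (φ (Metric.infDist y (F x)))

theorem infEDist_lt_ofReal_iff {W : Type*} [PseudoMetricSpace W] {x : W} {s : Set W} {r : ℝ} :
    Metric.infEDist x s < ENNReal.ofReal r ↔ (s ∩ Metric.ball x r).Nonempty := by
  rw [Metric.infEDist_lt_iff]
  refine exists_congr fun z => and_congr_right fun _ => ?_
  rw [edist_lt_ofReal, Metric.mem_ball, dist_comm]

theorem infEDist_le_ofReal_of_forall_between {W : Type*} [PseudoMetricSpace W] {x : W} {s : Set W}
    {r δ : ℝ} (hr : 0 ≤ r) (hrδ : r < δ)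
    (h : ∀ ρ, 0 < ρ → ρ < δ → r < ρ → (s ∩ Metric.ball x ρ).Nonempty) :
    Metric.infEDist x s ≤ ENNReal.ofReal r := by
  by_contra! hlt
  obtain ⟨q, hq, hrq, hqs⟩ := ENNReal.lt_iff_exists_real_btwn.1 hlt
  have hrq' : r < q := ENNReal.ofReal_lt_ofReal_iff'.1 hrq |>.1
  have hm : r < min q ((r + δ) / 2) := lt_min hrq' (by linarith)
  have hne := h _ (hr.trans_lt hm) (by have := min_le_right q ((r + δ) / 2); linarith) hm
  exact absurd ((infEDist_lt_ofReal_iff.2 hne).trans_le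
    (ENNReal.ofReal_le_ofReal (min_le_left _ _))) hqs.not_gt

theorem pi_norm_eq_iSup {n : ℕ} {X : Type*} [NormedAddCommGroup X] (x : Fin n → X) :
    ‖x‖ = ⨆ i, ‖x i‖ := by
  apply le_antisymm
  · exact (pi_norm_le_iff_of_nonneg (Real.iSup_nonneg fun i => norm_nonneg _)).2
      fun i => le_ciSup (f := fun i => ‖x i‖) (Set.finite_range _).bddAbove i
  · exact Real.iSup_le (norm_le_pi_norm x) (norm_nonneg x)

theorem infDist_pi_eq_iSup {n : ℕ} {X : Type*} [NormedAddCommGroup X] {Ω : Fin n → Set X}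
    (hΩ : ∀ i, (Ω i).Nonempty) (x : X) (y : Fin n → X) :
    Metric.infDist y {v : Fin n → X | ∀ i, v i + x ∈ Ω i} =
      ⨆ i, Metric.infDist (y i + x) (Ω i) := by
  have hsup : 0 ≤ ⨆ i, Metric.infDist (y i + x) (Ω i) :=
    Real.iSup_nonneg fun i => Metric.infDist_nonneg
  have hne : {v : Fin n → X | ∀ i, v i + x ∈ Ω i}.Nonempty :=
    ⟨fun i => (hΩ i).some - x, fun i => by simpa using (hΩ i).some_mem⟩
  apply le_antisymm
  · refine le_of_forall_gt_imp_ge_of_dense fun r hr => ?_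
    have hω : ∀ i, ∃ w ∈ Ω i, dist (y i + x) w < r := fun i =>
      (Metric.infDist_lt_iff (hΩ i)).1 <|
        (le_ciSup (f := fun i => Metric.infDist (y i + x) (Ω i))
          (Set.finite_range _).bddAbove i).trans_lt hr
    choose w hw hwr using hω
    refine (Metric.infDist_le_dist_of_mem (y := fun i => w i - x) fun i => by simpa using hw i).trans
      ((dist_pi_le_iff (hsup.trans hr.le)).2 fun i => ?_)
    simpa [dist_eq_norm, sub_sub_eq_add_sub] using (hwr i).le
  · refine Real.iSup_le (fun i => (Metric.le_infDist hne).2 fun v hv => ?_) Metric.infDist_nonneg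
    refine (Metric.infDist_le_dist_of_mem (hv i)).trans ?_
    simpa using dist_le_pi_dist y v i

theorem mem_iInter_sub_image_iff {n : ℕ} {X : Type*} [AddCommGroup X] {Ω : Fin n → Set X}
    {x : Fin n → X} {z : X} :
    z ∈ ⋂ i, (fun u => u - x i) '' Ω i ↔ ∀ i, x i + z ∈ Ω i := by
  simp [sub_eq_iff_eq_add, add_comm]

theorem mem_iInter_sub_sub_image_iff {n : ℕ} {X : Type*} [AddCommGroup X] {Ω : Fin n → Set X}
    {ω x : Fin n → X} {z : X} :
    z ∈ ⋂ i, (fun u => u - ω i - x i) '' Ω i ↔ ∀ i, ω i + x i + z ∈ Ω i := by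
  simp only [sub_sub]
  exact mem_iInter_sub_image_iff (x := fun i => ω i + x i)

/-- Theorem 5.1: with `F(x) = (Ω₁ − x) × ⋯ × (Ωₙ − x)` (so `(0,…,0) ∈ F(x₀)`, and
`Xⁿ` carrying the maximum norm), `{Ω₁,…,Ωₙ}` is `φ`-semitransversal (resp.
`φ`-subtransversal) at `x₀` with given `δ`'s iff `F` is `φ`-semiregular (resp.
`φ`-subregular) at `(x₀,0)` with the same `δ`'s; and `φ`-transversality with `δ₁, δ₂`
yields `φ`-regularity with any `δ₁' ∈ (0,δ₁]`, `δ₂' > 0` with `φ⁻¹(δ₁') + δ₂' ≤ δ₂`,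
and vice versa. -/
theorem transversality_iff_regularity {n : ℕ} (Ω : Fin n → Set X) (x₀ : X)
    (hx₀ : x₀ ∈ ⋂ i, Ω i)
    (φ φinv : ℝ → ℝ) (hmono : StrictMonoOn φ (Set.Ici 0)) (hcont : ContinuousOn φ (Set.Ici 0))
    (hzero : φ 0 = 0) (hlim : Tendsto φ atTop atTop)
    (hinv₁ : ∀ t : ℝ, 0 ≤ t → φinv (φ t) = t) (hinv₂ : ∀ t : ℝ, 0 ≤ t → φ (φinv t) = t)
    (hinvnn : ∀ t : ℝ, 0 ≤ t → 0 ≤ φinv t)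
    (F : X → Set (Fin n → X)) (hF : ∀ x, F x = {y : Fin n → X | ∀ i, y i + x ∈ Ω i}) :
    (∀ δ : ℝ, 0 < δ →
      (SemitransversalWith Ω x₀ φ δ ↔ SemiregularWith F x₀ (0 : Fin n → X) φ δ)) ∧
    (∀ δ₁ δ₂ : ℝ, 0 < δ₁ → 0 < δ₂ →
      (SubtransversalWith Ω x₀ φ δ₁ δ₂ ↔ SubregularWith F x₀ (0 : Fin n → X) φ δ₁ δ₂)) ∧
    (∀ δ₁ δ₂ : ℝ, 0 < δ₁ → 0 < δ₂ → TransversalWith Ω x₀ φ δ₁ δ₂ →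
      ∀ δ₁' δ₂' : ℝ, 0 < δ₁' → δ₁' ≤ δ₁ → 0 < δ₂' → φinv δ₁' + δ₂' ≤ δ₂ →
        RegularWith F x₀ (0 : Fin n → X) φ δ₁' δ₂') ∧
    (∀ δ₁ δ₂ : ℝ, 0 < δ₁ → 0 < δ₂ → RegularWith F x₀ (0 : Fin n → X) φ δ₁ δ₂ →
      ∀ δ₁' δ₂' : ℝ, 0 < δ₁' → δ₁' ≤ δ₁ → 0 < δ₂' → φinv δ₁' + δ₂' ≤ δ₂ →
        TransversalWith Ω x₀ φ δ₁' δ₂') := by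
  obtain rfl : F = fun x => {y : Fin n → X | ∀ i, y i + x ∈ Ω i} := funext hF
  have hx₀' : ∀ i, x₀ ∈ Ω i := Set.mem_iInter.1 hx₀
  have hΩ : ∀ i, (Ω i).Nonempty := fun i => ⟨x₀, hx₀' i⟩
  have hne : ∀ x, {y : Fin n → X | ∀ i, y i + x ∈ Ω i}.Nonempty := fun x =>
    ⟨fun _ => x₀ - x, fun i => by simpa using hx₀' i⟩
  have hφ_nonneg : ∀ t, 0 ≤ t → 0 ≤ φ t := fun t ht =>
    hzero ▸ hmono.monotoneOn (Set.mem_Ici.2 le_rfl) (Set.mem_Ici.2 ht) ht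
  have lt_inv : ∀ {t ρ}, 0 ≤ t → 0 ≤ ρ → φ t < ρ → t < φinv ρ := fun {t ρ} ht hρ h =>
    (hmono.lt_iff_lt ht (hinvnn ρ hρ)).1 (by rwa [hinv₂ ρ hρ])
  have φ_lt : ∀ {t ρ}, 0 ≤ t → 0 ≤ ρ → t < φinv ρ → φ t < ρ := fun {t ρ} ht hρ h =>
    (hmono ht (hinvnn ρ hρ) h).trans_eq (hinv₂ ρ hρ)
  refine ⟨fun δ hδ => ⟨fun h y hy => ?_, fun h ρ hρ hρδ x hx => ?_⟩,
    fun δ₁ δ₂ hδ₁ hδ₂ => ⟨fun h x hx _ hd => ?_, fun h ρ hρ hρδ x hx hd => ?_⟩,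
    fun δ₁ δ₂ hδ₁ hδ₂ h δ₁' δ₂' hδ₁' hle hδ₂' hsum x y hxy _ hd => ?_,
    fun δ₁ δ₂ hδ₁ hδ₂ h δ₁' δ₂' hδ₁' hle hδ₂' hsum ρ hρ hρδ ω x hω hx => ?_⟩
  · refine infEDist_le_ofReal_of_forall_between (hφ_nonneg _ dist_nonneg) hy fun ρ hρ hρδ hyρ => ?_
    rw [dist_zero_right, pi_norm_eq_iSup] at hyρ
    obtain ⟨z, hz, hzρ⟩ := h ρ hρ hρδ y hyρ
    exact ⟨z, mem_iInter_sub_image_iff.1 hz, hzρ⟩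
  · rw [← pi_norm_eq_iSup, ← dist_zero_right] at hx
    obtain ⟨z, hz, hzρ⟩ := infEDist_lt_ofReal_iff.1
      ((h x (hx.trans hρδ)).trans_lt ((ENNReal.ofReal_lt_ofReal_iff hρ).2 hx))
    exact ⟨z, mem_iInter_sub_image_iff.2 hz, hzρ⟩
  · refine infEDist_le_ofReal_of_forall_between (hφ_nonneg _ Metric.infDist_nonneg) hd
      fun ρ hρ hρδ hdρ => ?_
    simp only [infDist_pi_eq_iSup hΩ, Pi.zero_apply, zero_add] at hdρ
    obtain ⟨z, hz, hzρ⟩ := h ρ hρ hρδ x hx hdρ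
    exact ⟨z, fun i => by simpa using Set.mem_iInter.1 hz i, hzρ⟩
  · have hd' : φ (Metric.infDist (0 : Fin n → X) {y | ∀ i, y i + x ∈ Ω i}) < ρ := by
      simpa only [infDist_pi_eq_iSup hΩ, Pi.zero_apply, zero_add] using hd
    obtain ⟨z, hz, hzρ⟩ := infEDist_lt_ofReal_iff.1
      ((h x hx (hne x) (hd'.trans hρδ)).trans_lt ((ENNReal.ofReal_lt_ofReal_iff hρ).2 hd'))
    exact ⟨z, Set.mem_iInter.2 fun i => by simpa using hz i, hzρ⟩
  · refine infEDist_le_ofReal_of_forall_between (hφ_nonneg _ Metric.infDist_nonneg) hd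
      fun ρ hρ hρδ hdρ => ?_
    obtain ⟨v, hv, hyv⟩ :=
      (Metric.infDist_lt_iff (hne x)).1 (lt_inv Metric.infDist_nonneg hρ.le hdρ)
    have hφv : φ (dist y v) < ρ := φ_lt dist_nonneg hρ.le hyv
    have hv_lt : dist y v < φinv δ₁' := lt_inv dist_nonneg hδ₁'.le (hφv.trans hρδ)
    have hv_ball : ∀ i, v i + x ∈ Metric.ball x₀ δ₂ := fun i => by
      have h₁ : ‖v i‖ ≤ dist y v + dist y 0 := by
        refine (norm_le_pi_norm v i).trans ?_
        rw [← dist_zero_right, dist_comm y v]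
        exact dist_triangle v y 0
      have h₂ : dist (v i + x) x₀ ≤ ‖v i‖ + dist x x₀ := by
        rw [dist_eq_norm, dist_eq_norm, add_sub_assoc]
        exact norm_add_le _ _
      rw [Metric.mem_ball]
      linarith
    obtain ⟨z, hz, hzρ⟩ := h ρ hρ (hρδ.trans_le hle) (fun i => v i + x) (y - v)
      (fun i => ⟨hv i, hv_ball i⟩) (by rwa [← pi_norm_eq_iSup, ← dist_eq_norm])
    refine ⟨x + z, fun i => ?_, by simpa using hzρ⟩
    convert mem_iInter_sub_sub_image_iff.1 hz i using 1
    simp only [Pi.sub_apply]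
    abel
  · rw [← pi_norm_eq_iSup] at hx
    have hx_lt : ‖x‖ < φinv δ₁' := lt_inv (norm_nonneg x) hδ₁'.le (hx.trans hρδ)
    set y : Fin n → X := fun i => ω i + x i - x₀ with hy
    have hyδ : dist x₀ x₀ + dist y 0 < δ₂ := by
      rw [dist_self, zero_add, dist_pi_lt_iff hδ₂]
      intro i
      have h₁ : dist (ω i) x₀ < δ₂' := (hω i).2
      have h₂ : ‖y i‖ ≤ dist (ω i) x₀ + ‖x i‖ := by
        rw [dist_eq_norm, hy]
        simpa only [add_sub_right_comm] using norm_add_le (ω i - x₀) (x i)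
      have h₃ := norm_le_pi_norm x i
      rw [Pi.zero_apply, dist_zero_right]
      linarith
    have hyx : Metric.infDist y {y | ∀ i, y i + x₀ ∈ Ω i} ≤ ‖x‖ := by
      refine (Metric.infDist_le_dist_of_mem (y := fun i => ω i - x₀)
        fun i => by simpa using (hω i).1).trans_eq ?_
      rw [dist_eq_norm]
      congr 1
      ext i
      simp [hy]
    have hd : φ (Metric.infDist y {y | ∀ i, y i + x₀ ∈ Ω i}) < ρ :=
      (hmono.monotoneOn (Set.mem_Ici.2 Metric.infDist_nonneg) (norm_nonneg x) hyx).trans_lt hx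
    obtain ⟨z, hz, hzρ⟩ := infEDist_lt_ofReal_iff.1
      ((h x₀ y hyδ (hne x₀) (hd.trans (hρδ.trans_le hle))).trans_lt
        ((ENNReal.ofReal_lt_ofReal_iff hρ).2 hd))
    refine ⟨z - x₀, mem_iInter_sub_sub_image_iff.2 fun i => ?_, ?_⟩
    · convert hz i using 1
      simp only [hy]
      abel
    · simpa [dist_eq_norm] using hzρ
end

section
/- Let X and Y be normed vector spaces, F : X ⇒ Y a set-valued mapping, (x̄,ȳ) ∈ gph F, and let φ : [0,∞) → [0,∞) be continuous, strictly increasing, with φ(0) = 0 and φ(t) → ∞ as t → ∞. Let Ω₁ := gph F and Ω₂ := X × {ȳ} be subsets of X × Y equipped with the maximum norm ‖(x,y)‖ := max{‖x‖,‖y‖}, and let ψ(t) := φ(2t) + t for all t ≥ 0. Then: (i) if F is φ-semiregular at (x̄,ȳ) with some δ > 0, then {Ω₁,Ω₂} is ψ-semitransversal at (x̄,ȳ) with δ' := δ + φ⁻¹(δ)/2; (ii) if F is φ-subregular at (x̄,ȳ) with some δ₁ > 0 and δ₂ > 0, then {Ω₁,Ω₂} is ψ-subtransversal at (x̄,ȳ)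 with any δ₁' > 0 and δ₂' > 0 such that φ(2ψ⁻¹(δ₁')) ≤ δ₁ and ψ⁻¹(δ₁') + δ₂' ≤ δ₂; (iii) if F is φ-regular at (x̄,ȳ) with some δ₁ > 0 and δ₂ > 0, then {Ω₁,Ω₂} is ψ-transversal at (x̄,ȳ) with any δ₁' > 0 and δ₂' > 0 such that φ(2ψ⁻¹(δ₁')) ≤ δ₁ and ψ⁻¹(δ₁') + δ₂' ≤ δ₂/2. -/
open Set Filter
open scoped ENNReal

/-- The pair `{A,B}` is `χ`-semitransversal at `z₀` with `δ > 0`. -/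
def PairSemitransversalWith {Z : Type*} [NormedAddCommGroup Z]
    (A B : Set Z) (z₀ : Z) (χ : ℝ → ℝ) (δ : ℝ) : Prop :=
  ∀ ρ : ℝ, 0 < ρ → ρ < δ → ∀ z₁ z₂ : Z, χ (max ‖z₁‖ ‖z₂‖) < ρ →
    (((fun u => u - z₁) '' A) ∩ ((fun u => u - z₂) '' B) ∩ Metric.ball z₀ ρ).Nonempty

/-- The pair `{A,B}` is `χ`-subtransversal at `z₀` with `δ₁, δ₂ > 0`. -/
def PairSubtransversalWith {Z : Type*} [NormedAddCommGroup Z]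
    (A B : Set Z) (z₀ : Z) (χ : ℝ → ℝ) (δ₁ δ₂ : ℝ) : Prop :=
  ∀ ρ : ℝ, 0 < ρ → ρ < δ₁ → ∀ z ∈ Metric.ball z₀ δ₂,
    χ (max (Metric.infDist z A) (Metric.infDist z B)) < ρ →
    (A ∩ B ∩ Metric.ball z ρ).Nonempty

/-- The pair `{A,B}` is `χ`-transversal at `z₀` with `δ₁, δ₂ > 0`. -/
def PairTransversalWith {Z : Type*} [NormedAddCommGroup Z]
    (A B : Set Z) (z₀ : Z) (χ : ℝ → ℝ) (δ₁ δ₂ : ℝ) : Prop :=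
  ∀ ρ : ℝ, 0 < ρ → ρ < δ₁ → ∀ ω₁ ∈ A ∩ Metric.ball z₀ δ₂, ∀ ω₂ ∈ B ∩ Metric.ball z₀ δ₂,
    ∀ z₁ z₂ : Z, χ (max ‖z₁‖ ‖z₂‖) < ρ →
    (((fun u => u - ω₁ - z₁) '' A) ∩ ((fun u => u - ω₂ - z₂) '' B) ∩
      Metric.ball (0 : Z) ρ).Nonempty

/-- If the distance from `x` to `S` is at most `r < s`, some point of `S` lies within `s` of `x`. -/
theorem exists_mem_dist_lt_of_infEDist_le_ofReal {W : Type*} [PseudoMetricSpace W] {x : W}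
    {S : Set W} {r s : ℝ} (hs : 0 < s) (h : Metric.infEDist x S ≤ ENNReal.ofReal r)
    (hrs : r < s) : ∃ y ∈ S, dist x y < s := by
  obtain ⟨y, hy, hxy⟩ := Metric.infEDist_lt_iff.1
    (h.trans_lt ((ENNReal.ofReal_lt_ofReal_iff hs).2 hrs))
  exact ⟨y, hy, by rwa [edist_dist, ENNReal.ofReal_lt_ofReal_iff hs] at hxy⟩

theorem strictMonoOn_comp_two_mul_add {φ : ℝ → ℝ} (hmono : StrictMonoOn φ (Ici 0)) :
    StrictMonoOn (fun t => φ (2 * t) + t) (Ici 0) := fun a ha b hb hab =>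
  add_lt_add (hmono (by simpa using ha) (by simpa using hb) (by linarith)) hab

theorem nonneg_of_strictMonoOn_Ici {φ : ℝ → ℝ} (hmono : StrictMonoOn φ (Ici 0))
    (hzero : φ 0 = 0) {t : ℝ} (ht : 0 ≤ t) : 0 ≤ φ t :=
  hzero ▸ hmono.monotoneOn self_mem_Ici ht ht

/-- Comparison of `φ (2 * t) + t` at `m` and `s` yields comparison of `m` with `s` and of
`φ (2 * m)` with `φ (2 * s)`. -/
theorem lt_and_lt_of_comp_two_mul_add_lt {φ : ℝ → ℝ} (hmono : StrictMonoOn φ (Ici 0)) {m s : ℝ}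
    (hm : 0 ≤ m) (hs : 0 ≤ s) (h : φ (2 * m) + m < φ (2 * s) + s) :
    m < s ∧ φ (2 * m) < φ (2 * s) := by
  have hlt : m < s := ((strictMonoOn_comp_two_mul_add hmono).lt_iff_lt hm hs).1 h
  exact ⟨hlt, hmono (by simpa using hm) (by simpa using hs) (by linarith)⟩

theorem SemiregularWith.pairSemitransversalWith {X Y : Type*} [NormedAddCommGroup X]
    [NormedAddCommGroup Y] {F : X → Set Y} {x₀ : X} {y₀ : Y} {φ : ℝ → ℝ} {s : ℝ}
    (hF : SemiregularWith F x₀ y₀ φ (φ (2 * s))) (hmono : StrictMonoOn φ (Ici 0))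
    (hzero : φ 0 = 0) (hs : 0 ≤ s) :
    PairSemitransversalWith {p : X × Y | p.2 ∈ F p.1} {p : X × Y | p.2 = y₀} (x₀, y₀)
      (fun t => φ (2 * t) + t) (φ (2 * s) + s) := by
  rintro ρ hρ hρs ⟨u₁, v₁⟩ ⟨u₂, v₂⟩ hm
  have hu₁ : ‖u₁‖ ≤ max ‖(u₁, v₁)‖ ‖(u₂, v₂)‖ := (norm_fst_le (u₁, v₁)).trans (le_max_left _ _)
  have hv₁ : ‖v₁‖ ≤ max ‖(u₁, v₁)‖ ‖(u₂, v₂)‖ := (norm_snd_le (u₁, v₁)).trans (le_max_left _ _)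
  have hv₂ : ‖v₂‖ ≤ max ‖(u₁, v₁)‖ ‖(u₂, v₂)‖ := (norm_snd_le (u₂, v₂)).trans (le_max_right _ _)
  generalize max ‖(u₁, v₁)‖ ‖(u₂, v₂)‖ = m at hm hu₁ hv₁ hv₂
  dsimp only at hm
  have hm0 : 0 ≤ m := (norm_nonneg _).trans hu₁
  have hφm := (lt_and_lt_of_comp_two_mul_add_lt hmono hm0 hs (hm.trans hρs)).2
  have hd : dist (y₀ - v₂ + v₁) y₀ ≤ 2 * m := by
    rw [dist_eq_norm, show y₀ - v₂ + v₁ - y₀ = v₁ - v₂ by abel]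
    linarith [norm_sub_le v₁ v₂]
  have hφd := hmono.monotoneOn (mem_Ici.2 dist_nonneg) (mem_Ici.2 (dist_nonneg.trans hd)) hd
  have hφm0 := nonneg_of_strictMonoOn_Ici hmono hzero (dist_nonneg.trans hd)
  obtain ⟨x, hx, hxd⟩ := exists_mem_dist_lt_of_infEDist_le_ofReal (s := ρ - m) (by linarith)
    (hF _ (hφd.trans_lt hφm)) (by linarith)
  refine ⟨(x - u₁, y₀ - v₂), ⟨⟨(x, y₀ - v₂ + v₁), hx, ?_⟩, ⟨(x - u₁ + u₂, y₀), rfl, ?_⟩⟩, ?_⟩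
  · simp
  · simp
  · rw [Metric.mem_ball, Prod.dist_eq]
    refine max_lt ?_ ?_
    · rw [dist_eq_norm'] at hxd
      rw [dist_eq_norm, show x - u₁ - x₀ = (x - x₀) - u₁ by abel]
      linarith [norm_sub_le (x - x₀) u₁]
    · simp only [dist_eq_norm, sub_sub_cancel_left, norm_neg]
      linarith

theorem SubregularWith.pairSubtransversalWith {X Y : Type*} [NormedAddCommGroup X]
    [NormedAddCommGroup Y] {F : X → Set Y} {x₀ : X} {y₀ : Y} {φ : ℝ → ℝ} {δ₁ δ₂ δ s : ℝ}
    (hF : SubregularWith F x₀ y₀ φ δ₁ δ₂) (hy₀ : y₀ ∈ F x₀) (hmono : StrictMonoOn φ (Ici 0))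
    (hcont : ContinuousOn φ (Ici 0)) (hzero : φ 0 = 0) (hs : 0 ≤ s)
    (h₁ : φ (2 * s) ≤ δ₁) (h₂ : s + δ ≤ δ₂) :
    PairSubtransversalWith {p : X × Y | p.2 ∈ F p.1} {p : X × Y | p.2 = y₀} (x₀, y₀)
      (fun t => φ (2 * t) + t) (φ (2 * s) + s) δ := by
  rintro ρ hρ hρs ⟨x, y⟩ hz hρm
  have hA : Set.Nonempty {p : X × Y | p.2 ∈ F p.1} := ⟨(x₀, y₀), hy₀⟩
  have hB : Set.Nonempty {p : X × Y | p.2 = y₀} := ⟨(x₀, y₀), rfl⟩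
  obtain ⟨m, hm, hlt⟩ : ∃ m, φ (2 * m) + m < ρ ∧
      max (Metric.infDist (x, y) {p : X × Y | p.2 ∈ F p.1})
        (Metric.infDist (x, y) {p : X × Y | p.2 = y₀}) < m := by
    have hnonneg : 0 ≤ max (Metric.infDist (x, y) {p : X × Y | p.2 ∈ F p.1})
        (Metric.infDist (x, y) {p : X × Y | p.2 = y₀}) :=
      Metric.infDist_nonneg.trans (le_max_left _ _)
    generalize max (Metric.infDist (x, y) {p : X × Y | p.2 ∈ F p.1})
      (Metric.infDist (x, y) {p : X × Y | p.2 = y₀}) = r at hρm hnonneg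
    have hψcont : ContinuousOn (fun t => φ (2 * t) + t) (Ici 0) :=
      (hcont.comp (by fun_prop) fun t ht => by simpa using ht).add continuousOn_id
    have hev : ∀ᶠ t in nhdsWithin r (Ioi r), φ (2 * t) + t < ρ :=
      ((hψcont r hnonneg).mono fun t ht => hnonneg.trans (le_of_lt ht)).eventually_lt_const hρm
    exact (hev.and self_mem_nhdsWithin).exists
  obtain ⟨hltA, hltB⟩ := max_lt_iff.1 hlt
  have hm0 : 0 ≤ m := Metric.infDist_nonneg.trans hltA.le
  obtain ⟨hms, hφm⟩ := lt_and_lt_of_comp_two_mul_add_lt hmono hm0 hs (hm.trans hρs)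
  obtain ⟨⟨a, b⟩, hab, hdab⟩ := (Metric.infDist_lt_iff hA).1 hltA
  obtain ⟨⟨c, d⟩, hcd, hdcd⟩ := (Metric.infDist_lt_iff hB).1 hltB
  obtain rfl : d = y₀ := hcd
  rw [Prod.dist_eq, max_lt_iff] at hdab hdcd
  rw [Metric.mem_ball, Prod.dist_eq, max_lt_iff] at hz
  dsimp only at hdab hdcd hz
  have hd : Metric.infDist d (F a) ≤ 2 * m :=
    (Metric.infDist_le_dist_of_mem (show b ∈ F a from hab)).trans
      (by linarith [dist_triangle_left d b y])
  have hd0 : 0 ≤ Metric.infDist d (F a) := Metric.infDist_nonneg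
  have hφd := hmono.monotoneOn (mem_Ici.2 hd0) (mem_Ici.2 (hd0.trans hd)) hd
  have hφm0 := nonneg_of_strictMonoOn_Ici hmono hzero (hd0.trans hd)
  obtain ⟨x', hx', hxd⟩ := exists_mem_dist_lt_of_infEDist_le_ofReal (s := ρ - m) (by linarith)
    (hF a (by rw [Metric.mem_ball]; linarith [dist_triangle_left a x₀ x]) ⟨b, hab⟩
      (by linarith)) (by linarith)
  refine ⟨(x', d), ⟨hx', rfl⟩, ?_⟩
  rw [Metric.mem_ball, dist_comm, Prod.dist_eq]
  exact max_lt (by linarith [dist_triangle x a x']) (by linarith)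

theorem RegularWith.pairTransversalWith {X Y : Type*} [NormedAddCommGroup X]
    [NormedAddCommGroup Y] {F : X → Set Y} {x₀ : X} {y₀ : Y} {φ : ℝ → ℝ} {δ₁ δ₂ δ s : ℝ}
    (hF : RegularWith F x₀ y₀ φ δ₁ δ₂) (hmono : StrictMonoOn φ (Ici 0))
    (hzero : φ 0 = 0) (hs : 0 ≤ s) (h₁ : φ (2 * s) ≤ δ₁) (h₂ : s + δ ≤ δ₂ / 2) :
    PairTransversalWith {p : X × Y | p.2 ∈ F p.1} {p : X × Y | p.2 = y₀} (x₀, y₀)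
      (fun t => φ (2 * t) + t) (φ (2 * s) + s) δ := by
  rintro ρ hρ hρs ⟨a, b⟩ ⟨hab, habd⟩ ⟨c, d⟩ ⟨hcd, -⟩ ⟨u₁, v₁⟩ ⟨u₂, v₂⟩ hm
  obtain rfl : d = y₀ := hcd
  have hu₁ : ‖u₁‖ ≤ max ‖(u₁, v₁)‖ ‖(u₂, v₂)‖ := (norm_fst_le (u₁, v₁)).trans (le_max_left _ _)
  have hv₁ : ‖v₁‖ ≤ max ‖(u₁, v₁)‖ ‖(u₂, v₂)‖ := (norm_snd_le (u₁, v₁)).trans (le_max_left _ _)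
  have hv₂ : ‖v₂‖ ≤ max ‖(u₁, v₁)‖ ‖(u₂, v₂)‖ := (norm_snd_le (u₂, v₂)).trans (le_max_right _ _)
  generalize max ‖(u₁, v₁)‖ ‖(u₂, v₂)‖ = m at hm hu₁ hv₁ hv₂
  dsimp only at hm
  have hm0 : 0 ≤ m := (norm_nonneg _).trans hu₁
  obtain ⟨hms, hφm⟩ := lt_and_lt_of_comp_two_mul_add_lt hmono hm0 hs (hm.trans hρs)
  rw [Metric.mem_ball, Prod.dist_eq, max_lt_iff] at habd
  dsimp only at habd
  have hdb : dist (b + v₁ - v₂) b ≤ 2 * m := by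
    rw [dist_eq_norm, show b + v₁ - v₂ - b = v₁ - v₂ by abel]
    linarith [norm_sub_le v₁ v₂]
  have hd : Metric.infDist (b + v₁ - v₂) (F a) ≤ 2 * m :=
    (Metric.infDist_le_dist_of_mem (show b ∈ F a from hab)).trans hdb
  have hd0 : 0 ≤ Metric.infDist (b + v₁ - v₂) (F a) := Metric.infDist_nonneg
  have hφd := hmono.monotoneOn (mem_Ici.2 hd0) (mem_Ici.2 (hd0.trans hd)) hd
  have hφm0 := nonneg_of_strictMonoOn_Ici hmono hzero (hd0.trans hd)
  obtain ⟨x, hx, hxd⟩ := exists_mem_dist_lt_of_infEDist_le_ofReal (s := ρ - m) (by linarith)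
    (hF a (b + v₁ - v₂) (by linarith [dist_triangle (b + v₁ - v₂) b d]) ⟨b, hab⟩
      (by linarith)) (by linarith)
  refine ⟨(x - a - u₁, -v₂), ⟨⟨(x, b + v₁ - v₂), hx, ?_⟩,
    ⟨(x - a - u₁ + c + u₂, d), rfl, ?_⟩⟩, ?_⟩
  · refine Prod.ext rfl ?_
    change b + v₁ - v₂ - b - v₁ = -v₂
    abel
  · refine Prod.ext ?_ ?_
    · change x - a - u₁ + c + u₂ - c - u₂ = x - a - u₁
      abel
    · change d - d - v₂ = -v₂
      abel
  · rw [mem_ball_zero_iff, Prod.norm_def]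
    rw [dist_eq_norm'] at hxd
    refine max_lt ?_ ?_
    · change ‖x - a - u₁‖ < ρ
      linarith [norm_sub_le (x - a) u₁]
    · change ‖-v₂‖ < ρ
      rw [norm_neg]
      linarith

/-- Theorem 5.2: regularity of `F` implies transversality of `{gph F, X × {y₀}}` in
`X × Y` (with the maximum norm) with respect to `ψ(t) = φ(2t) + t`. -/
theorem transversality_of_regularity {X Y : Type*} [NormedAddCommGroup X]
    [NormedSpace ℝ X] [NormedAddCommGroup Y] [NormedSpace ℝ Y]
    (F : X → Set Y) (x₀ : X) (y₀ : Y) (hy₀ : y₀ ∈ F x₀)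
    (φ φinv ψ ψinv : ℝ → ℝ)
    (hmono : StrictMonoOn φ (Set.Ici 0)) (hcont : ContinuousOn φ (Set.Ici 0))
    (hzero : φ 0 = 0) (hlim : Tendsto φ atTop atTop)
    (hψ : ∀ t : ℝ, ψ t = φ (2 * t) + t)
    (hinv₁ : ∀ t : ℝ, 0 ≤ t → φinv (φ t) = t) (hinv₂ : ∀ t : ℝ, 0 ≤ t → φ (φinv t) = t)
    (hinvnn : ∀ t : ℝ, 0 ≤ t → 0 ≤ φinv t)
    (hψinv₁ : ∀ t : ℝ, 0 ≤ t → ψinv (ψ t) = t) (hψinv₂ : ∀ t : ℝ, 0 ≤ t → ψ (ψinv t) = t)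
    (hψinvnn : ∀ t : ℝ, 0 ≤ t → 0 ≤ ψinv t) :
    (∀ δ : ℝ, 0 < δ → SemiregularWith F x₀ y₀ φ δ →
      PairSemitransversalWith {p : X × Y | p.2 ∈ F p.1} {p : X × Y | p.2 = y₀}
        (x₀, y₀) ψ (δ + φinv δ / 2)) ∧
    (∀ δ₁ δ₂ : ℝ, 0 < δ₁ → 0 < δ₂ → SubregularWith F x₀ y₀ φ δ₁ δ₂ →
      ∀ δ₁' δ₂' : ℝ, 0 < δ₁' → 0 < δ₂' → φ (2 * ψinv δ₁') ≤ δ₁ → ψinv δ₁' + δ₂' ≤ δ₂ →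
        PairSubtransversalWith {p : X × Y | p.2 ∈ F p.1} {p : X × Y | p.2 = y₀}
          (x₀, y₀) ψ δ₁' δ₂') ∧
    (∀ δ₁ δ₂ : ℝ, 0 < δ₁ → 0 < δ₂ → RegularWith F x₀ y₀ φ δ₁ δ₂ →
      ∀ δ₁' δ₂' : ℝ, 0 < δ₁' → 0 < δ₂' → φ (2 * ψinv δ₁') ≤ δ₁ → ψinv δ₁' + δ₂' ≤ δ₂ / 2 →
        PairTransversalWith {p : X × Y | p.2 ∈ F p.1} {p : X × Y | p.2 = y₀}
          (x₀, y₀) ψ δ₁' δ₂') := by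
  obtain rfl : ψ = fun t => φ (2 * t) + t := funext hψ
  dsimp only at hψinv₂
  refine ⟨fun δ hδ hF => ?_, fun δ₁ δ₂ _ _ hF δ₁' δ₂' hδ₁' _ h₁ h₂ => ?_,
    fun δ₁ δ₂ _ _ hF δ₁' δ₂' hδ₁' _ h₁ h₂ => ?_⟩
  · have hφ : φ (2 * (φinv δ / 2)) = δ := by
      rw [mul_div_cancel₀ _ two_ne_zero, hinv₂ δ hδ.le]
    have h := SemiregularWith.pairSemitransversalWith (s := φinv δ / 2) (by rwa [hφ]) hmono hzero
      (div_nonneg (hinvnn δ hδ.le) two_pos.le)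
    rwa [hφ] at h
  · have h := hF.pairSubtransversalWith hy₀ hmono hcont hzero (hψinvnn _ hδ₁'.le) h₁ h₂
    rwa [hψinv₂ _ hδ₁'.le] at h
  · have h := hF.pairTransversalWith hmono hzero (hψinvnn _ hδ₁'.le) h₁ h₂
    rwa [hψinv₂ _ hδ₁'.le] at h
end

section
/- Let X and Y be normed vector spaces, F : X ⇒ Y a set-valued mapping, (x̄,ȳ) ∈ gph F, and let φ : [0,∞) → [0,∞) be continuous, strictly increasing, with φ(0) = 0 and φ(t) → ∞ as t → ∞. Let Ω₁ := gph F and Ω₂ := X × {ȳ} be subsets of X × Y equipped with the maximum norm ‖(x,y)‖ := max{‖x‖,‖y‖}, and let ψ(t) := φ(t/2) for all t ≥ 0. Then: (i) if {Ω₁,Ω₂} is φ-semitransversal at (x̄,ȳ) with some δ > 0, then F is ψ-semiregular at (x̄,ȳ) with δ; (ii) if {Ω₁,Ω₂} is φ-subtransversal at (x̄,ȳ) with some δ₁ > 0 and δ₂ > 0, then F is ψ-subregular at (x̄,ȳ) with δ₁' := min{δ₁, ψ(2δ₂)} and δ₂; (iii) if {Ω₁,Ω₂} is φ-transversal at (x̄,ȳ)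 with some δ₁ > 0 and δ₂ > 0, then F is ψ-regular at (x̄,ȳ) with any δ₁' ∈ (0,δ₁) and δ₂' > 0 such that ψ⁻¹(δ₁') + δ₂' ≤ δ₂. -/
open Set Filter
open scoped ENNReal

/-- To bound the distance from a point to a set by `r`, it suffices to find points of the set at
distance less than `ρ` for all `ρ > r` close enough to `r`. -/
theorem infEDist_le_ofReal_of_forall_exists_dist_lt {W : Type*} [PseudoMetricSpace W] {s : Set W}
    {x : W} {r b : ℝ} (hrb : r < b) (h : ∀ ρ, r < ρ → ρ < b → ∃ x' ∈ s, dist x' x < ρ) :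
    Metric.infEDist x s ≤ ENNReal.ofReal r := by
  have hlim : Tendsto ENNReal.ofReal (nhdsWithin r (Ioi r)) (nhds (ENNReal.ofReal r)) :=
    (ENNReal.continuous_ofReal.tendsto r).mono_left nhdsWithin_le_nhds
  refine ge_of_tendsto hlim ?_
  filter_upwards [Ioo_mem_nhdsGT hrb] with ρ hρ
  obtain ⟨x', hx', hdist⟩ := h ρ hρ.1 hρ.2
  refine (Metric.infEDist_le_edist_of_mem hx').trans ?_
  rw [edist_dist, dist_comm]
  exact ENNReal.ofReal_le_ofReal hdist.le

/-- A gauge of the distance to a set can be approximated from above by the gauge of the distance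
to a point of that set. -/
theorem exists_mem_dist_lt_and_gauge_lt {W : Type*} [PseudoMetricSpace W] {s : Set W}
    (hs : s.Nonempty) {y : W} {φ : ℝ → ℝ} (hmono : MonotoneOn φ (Ici 0))
    (hcont : ContinuousOn φ (Ici 0)) {c ρ : ℝ} (hc : Metric.infDist y s < c)
    (hρ : φ (Metric.infDist y s / 2) < ρ) :
    ∃ v ∈ s, dist y v < c ∧ φ (dist y v / 2) < ρ := by
  have hd : 0 ≤ Metric.infDist y s := Metric.infDist_nonneg
  have hcomp : ContinuousOn (fun t => φ (t / 2)) (Ici 0) :=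
    hcont.comp (by fun_prop) fun t (ht : 0 ≤ t) => div_nonneg ht zero_le_two
  have hev : ∀ᶠ t in nhdsWithin (Metric.infDist y s) (Ioi (Metric.infDist y s)), φ (t / 2) < ρ :=
    (((hcomp _ hd).mono fun t ht => hd.trans (le_of_lt ht)).tendsto).eventually_lt_const hρ
  obtain ⟨t, hφt, hdt, htc⟩ := (hev.and (Ioo_mem_nhdsGT hc)).exists
  obtain ⟨v, hv, hvt⟩ := (Metric.infDist_lt_iff hs).1 hdt
  refine ⟨v, hv, hvt.trans htc, lt_of_le_of_lt (hmono ?_ ?_ ?_) hφt⟩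
  · exact div_nonneg dist_nonneg zero_le_two
  · exact div_nonneg (hd.trans hdt.le) zero_le_two
  · linarith

section

variable {X Y : Type*} [NormedAddCommGroup X] [NormedAddCommGroup Y] [NormedSpace ℝ Y]
  {F : X → Set Y} {x₀ : X} {y₀ : Y} {φ : ℝ → ℝ}

theorem norm_half_smul_sub (u v : Y) : ‖(2⁻¹ : ℝ) • (u - v)‖ = dist u v / 2 := by
  rw [norm_smul, dist_eq_norm, Real.norm_of_nonneg (by norm_num)]
  ring

theorem semiregularWith_of_pairSemitransversalWith (hmono : StrictMonoOn φ (Ici 0))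
    (hzero : φ 0 = 0) {δ : ℝ}
    (h : PairSemitransversalWith {p : X × Y | p.2 ∈ F p.1} {p : X × Y | p.2 = y₀} (x₀, y₀) φ δ) :
    SemiregularWith F x₀ y₀ (fun t => φ (t / 2)) δ := by
  intro y hy
  refine infEDist_le_ofReal_of_forall_exists_dist_lt hy fun ρ hρ hρδ => ?_
  have hdiv : 0 ≤ dist y y₀ / 2 := by positivity
  have hρ0 : 0 < ρ := lt_of_le_of_lt
    (hzero ▸ hmono.monotoneOn self_mem_Ici hdiv hdiv) hρ
  set w : Y := (2⁻¹ : ℝ) • (y - y₀) with hw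
  have hnorm : ‖w‖ = dist y y₀ / 2 := norm_half_smul_sub y y₀
  obtain ⟨_, ⟨⟨p, hp, rfl⟩, q, hq, hqp⟩, hball⟩ := h ρ hρ0 hρδ (0, w) (0, -w)
    (by simpa [Prod.norm_def, hnorm, hdiv] using hρ)
  simp only [mem_ofPred_eq] at hp hq
  simp only [Prod.ext_iff, Prod.fst_sub, Prod.snd_sub] at hqp
  have hpy : p.2 = y := by
    have hp2 : p.2 = q.2 + w + w := by
      rw [sub_neg_eq_add] at hqp
      rw [hqp.2, sub_add_cancel]
    rw [hp2, hq, hw]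
    module
  refine ⟨p.1, by simpa [hpy] using hp, ?_⟩
  rw [Metric.mem_ball, Prod.dist_eq, max_lt_iff] at hball
  simpa using hball.1

theorem subregularWith_of_pairSubtransversalWith (hmono : StrictMonoOn φ (Ici 0))
    (hcont : ContinuousOn φ (Ici 0)) (hzero : φ 0 = 0) {δ₁ δ₂ : ℝ} (hδ₂ : 0 < δ₂)
    (h : PairSubtransversalWith {p : X × Y | p.2 ∈ F p.1} {p : X × Y | p.2 = y₀}
      (x₀, y₀) φ δ₁ δ₂) :
    SubregularWith F x₀ y₀ (fun t => φ (t / 2)) (min δ₁ (φ (2 * δ₂ / 2))) δ₂ := by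
  intro x hx hne hlt
  obtain ⟨hlt₁, hlt₂⟩ := lt_min_iff.1 hlt
  have hd : 0 ≤ Metric.infDist y₀ (F x) / 2 := div_nonneg Metric.infDist_nonneg zero_le_two
  have hdδ : Metric.infDist y₀ (F x) < 2 * δ₂ := by
    have := (hmono.lt_iff_lt hd (show (0 : ℝ) ≤ 2 * δ₂ / 2 by positivity)).1 hlt₂
    linarith
  refine infEDist_le_ofReal_of_forall_exists_dist_lt hlt₁ fun ρ hρ hρδ => ?_
  have hρ0 : 0 < ρ := lt_of_le_of_lt (hzero ▸ hmono.monotoneOn self_mem_Ici hd hd) hρ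
  obtain ⟨v, hv, hvδ, hvρ⟩ :=
    exists_mem_dist_lt_and_gauge_lt hne hmono.monotoneOn hcont hdδ hρ
  set m : Y := y₀ + (2⁻¹ : ℝ) • (v - y₀) with hm
  have hmy : dist m y₀ = dist y₀ v / 2 := by
    rw [dist_eq_norm, hm, add_sub_cancel_left, norm_half_smul_sub, dist_comm]
  have hmv : dist m v = dist y₀ v / 2 := by
    rw [dist_eq_norm, ← norm_half_smul_sub, hm]
    congr 1
    module
  have hA : Metric.infDist (x, m) {p : X × Y | p.2 ∈ F p.1} ≤ dist y₀ v / 2 := by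
    refine (Metric.infDist_le_dist_of_mem (y := (x, v)) hv).trans ?_
    simp [Prod.dist_eq, hmv, div_nonneg dist_nonneg]
  have hB : Metric.infDist (x, m) {p : X × Y | p.2 = y₀} ≤ dist y₀ v / 2 := by
    refine (Metric.infDist_le_dist_of_mem (y := (x, y₀)) (mem_ofPred_eq ▸ rfl)).trans ?_
    simp [Prod.dist_eq, hmy, div_nonneg dist_nonneg]
  obtain ⟨p, ⟨hpA, hpB⟩, hp⟩ := h ρ hρ0 hρδ (x, m)
    (by
      rw [Metric.mem_ball, Prod.dist_eq]
      exact max_lt hx (by simp only [hmy]; linarith))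
    ((hmono.monotoneOn (le_max_of_le_left Metric.infDist_nonneg)
      (show (0 : ℝ) ≤ dist y₀ v / 2 by positivity) (max_le hA hB)).trans_lt hvρ)
  simp only [mem_ofPred_eq] at hpA hpB
  refine ⟨p.1, by simpa [hpB] using hpA, ?_⟩
  rw [Metric.mem_ball, Prod.dist_eq, max_lt_iff] at hp
  exact hp.1

theorem regularWith_of_pairTransversalWith (hmono : StrictMonoOn φ (Ici 0))
    (hcont : ContinuousOn φ (Ici 0)) (hzero : φ 0 = 0) {δ₁ δ₂ δ₁' δ₂' c : ℝ}
    (h : PairTransversalWith {p : X × Y | p.2 ∈ F p.1} {p : X × Y | p.2 = y₀} (x₀, y₀) φ δ₁ δ₂)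
    (hδ₁ : δ₁' < δ₁) (hc0 : 0 ≤ c) (hc : φ (c / 2) = δ₁') (hδ₂ : c + δ₂' ≤ δ₂) :
    RegularWith F x₀ y₀ (fun t => φ (t / 2)) δ₁' δ₂' := by
  intro x y hxy hne hlt
  have hd : 0 ≤ Metric.infDist y (F x) / 2 := div_nonneg Metric.infDist_nonneg zero_le_two
  have hdc : Metric.infDist y (F x) < c := by
    have := (hmono.lt_iff_lt hd (div_nonneg hc0 zero_le_two)).1 (hc ▸ hlt)
    linarith
  refine infEDist_le_ofReal_of_forall_exists_dist_lt (hlt.trans hδ₁) fun ρ hρ hρδ => ?_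
  have hρ0 : 0 < ρ := lt_of_le_of_lt (hzero ▸ hmono.monotoneOn self_mem_Ici hd hd) hρ
  obtain ⟨v, hv, hvc, hvρ⟩ :=
    exists_mem_dist_lt_and_gauge_lt hne hmono.monotoneOn hcont hdc hρ
  have hdiv : 0 ≤ dist y v / 2 := by positivity
  have hxx₀ : dist x x₀ < δ₂ := by linarith [dist_nonneg (x := y) (y := y₀)]
  have hvy₀ : dist v y₀ < δ₂ := by
    linarith [dist_triangle_left v y₀ y, dist_nonneg (x := x) (y := x₀)]
  set w : Y := (2⁻¹ : ℝ) • (y - v) with hw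
  have hnorm : ‖w‖ = dist y v / 2 := norm_half_smul_sub y v
  obtain ⟨_, ⟨⟨p, hp, rfl⟩, q, hq, hqp⟩, hball⟩ := h ρ hρ0 hρδ
    (x, v) ⟨hv, by simp [Prod.dist_eq, hxx₀, hvy₀]⟩
    (x, y₀) ⟨rfl, by simp [Prod.dist_eq, hxx₀]⟩ (0, w) (0, -w)
    (by simpa [Prod.norm_def, hnorm, hdiv] using hvρ)
  simp only [mem_ofPred_eq] at hp hq
  simp only [Prod.ext_iff, Prod.fst_sub, Prod.snd_sub] at hqp
  have hpy : p.2 = y := by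
    have hp2 : p.2 - v - w = w := by rw [← hqp.2, hq, sub_self, zero_sub, neg_neg]
    rw [sub_sub, sub_eq_iff_eq_add] at hp2
    rw [hp2, hw]
    module
  refine ⟨p.1, by simpa [hpy] using hp, ?_⟩
  rw [Metric.mem_ball, Prod.dist_eq, max_lt_iff] at hball
  simpa [dist_eq_norm] using hball.1

end

/-- Theorem 5.3: transversality of `{gph F, X × {y₀}}` in `X × Y` (with the maximum
norm) implies regularity of `F` with respect to `ψ(t) = φ(t/2)`. -/
theorem regularity_of_transversality {X Y : Type*} [NormedAddCommGroup X]
    [NormedSpace ℝ X] [NormedAddCommGroup Y] [NormedSpace ℝ Y]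
    (F : X → Set Y) (x₀ : X) (y₀ : Y) (hy₀ : y₀ ∈ F x₀)
    (φ ψ ψinv : ℝ → ℝ)
    (hmono : StrictMonoOn φ (Set.Ici 0)) (hcont : ContinuousOn φ (Set.Ici 0))
    (hzero : φ 0 = 0) (hlim : Tendsto φ atTop atTop)
    (hψ : ∀ t : ℝ, ψ t = φ (t / 2))
    (hψinv₁ : ∀ t : ℝ, 0 ≤ t → ψinv (ψ t) = t) (hψinv₂ : ∀ t : ℝ, 0 ≤ t → ψ (ψinv t) = t)
    (hψinvnn : ∀ t : ℝ, 0 ≤ t → 0 ≤ ψinv t) :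
    (∀ δ : ℝ, 0 < δ →
      PairSemitransversalWith {p : X × Y | p.2 ∈ F p.1} {p : X × Y | p.2 = y₀}
        (x₀, y₀) φ δ →
      SemiregularWith F x₀ y₀ ψ δ) ∧
    (∀ δ₁ δ₂ : ℝ, 0 < δ₁ → 0 < δ₂ →
      PairSubtransversalWith {p : X × Y | p.2 ∈ F p.1} {p : X × Y | p.2 = y₀}
        (x₀, y₀) φ δ₁ δ₂ →
      SubregularWith F x₀ y₀ ψ (min δ₁ (ψ (2 * δ₂))) δ₂) ∧
    (∀ δ₁ δ₂ : ℝ, 0 < δ₁ → 0 < δ₂ →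
      PairTransversalWith {p : X × Y | p.2 ∈ F p.1} {p : X × Y | p.2 = y₀}
        (x₀, y₀) φ δ₁ δ₂ →
      ∀ δ₁' δ₂' : ℝ, 0 < δ₁' → δ₁' < δ₁ → 0 < δ₂' → ψinv δ₁' + δ₂' ≤ δ₂ →
        RegularWith F x₀ y₀ ψ δ₁' δ₂') := by
  obtain rfl : ψ = fun t => φ (t / 2) := funext hψ
  refine ⟨fun δ _ h => semiregularWith_of_pairSemitransversalWith hmono hzero h,
    fun δ₁ δ₂ _ hδ₂ h => subregularWith_of_pairSubtransversalWith hmono hcont hzero hδ₂ h,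
    fun δ₁ δ₂ _ _ h δ₁' δ₂' hδ₁' hlt _ hle => ?_⟩
  exact regularWith_of_pairTransversalWith hmono hcont hzero h hlt (hψinvnn δ₁' hδ₁'.le)
    (hψinv₂ δ₁' hδ₁'.le) hle
end
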